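/- arXiv:2106.07880 — 5 statements merged into one kernel-verified Lean document; each statement's English description precedes it below -/
import Mathlib

section
/- For every ε > 0 and every integer p ≥ 1/(9·ε^{2/3}), the polynomial P_relu^(p)(α) := 1/π + α/2 + (1/π)·Σ_{i=0}^{p} (2i)!·α^{2i+2} / (2^{2i}·(i!)²·(2i+1)·(2i+2)) satisfies sup_{α∈[−1,1]} |P_relu^(p)(α) − κ1(α)| ≤ ε. -/
noncomputable def kappa1 (α : ℝ) : ℝ :=
  (1 / Real.pi) * (Real.sqrt (1 - α ^ 2) + α * (Real.pi - Real.arccos α))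

/-- the truncated Taylor polynomial `P_relu^(p)` approximating `κ1`. -/
noncomputable def Prelu (p : ℕ) (α : ℝ) : ℝ :=
  1 / Real.pi + α / 2 +
    (1 / Real.pi) * ∑ i ∈ Finset.range (p + 1),
      (Nat.factorial (2 * i) : ℝ) * α ^ (2 * i + 2) /
        (2 ^ (2 * i) * ((Nat.factorial i : ℝ)) ^ 2 * (2 * i + 1) * (2 * i + 2))

theorem aux_mvt (g g' : ℝ → ℝ) (r δ : ℝ) (h : ∀ t ∈ Set.Icc (0:ℝ) r, HasDerivAt g (g' t) t)
    (h0 : g 0 = 0) (hb : ∀ t ∈ Set.Icc (0:ℝ) r, 0 ≤ g' t ∧ g' t ≤ δ) :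
    ∀ t ∈ Set.Icc (0:ℝ) r, 0 ≤ g t ∧ g t ≤ δ * t := by
  have hc : ContinuousOn g (Set.Icc 0 r) := fun t ht => (h t ht).continuousAt.continuousWithinAt
  intro t ht
  constructor
  · refine image_le_of_deriv_right_le_deriv_boundary (f := fun _ => (0:ℝ)) (f' := fun _ => 0)
      (B := g) (B' := g') (a := 0) (b := r) continuousOn_const
      (fun x _ => hasDerivWithinAt_const _ _ _) h0.ge hc
      (fun x hx => (h x ⟨hx.1, hx.2.le⟩).hasDerivWithinAt)
      (fun x hx => (hb x ⟨hx.1, hx.2.le⟩).1) ht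
  · refine image_le_of_deriv_right_le_deriv_boundary (f := g) (f' := g')
      (B := fun t => δ * t) (B' := fun _ => δ) (a := 0) (b := r) hc
      (fun x hx => (h x ⟨hx.1, hx.2.le⟩).hasDerivWithinAt) (by simp [h0]) (by fun_prop)
      (fun x hx => ?_)
      (fun x hx => (hb x ⟨hx.1, hx.2.le⟩).2) ht
    simpa using ((hasDerivAt_id x).const_mul δ).hasDerivWithinAt

noncomputable def aa (i : ℕ) : ℝ :=
  (Nat.factorial (2 * i) : ℝ) / (2 ^ (2 * i) * ((Nat.factorial i : ℝ)) ^ 2)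

noncomputable def cc (i : ℕ) : ℝ := aa i / ((2 * i + 1) * (2 * i + 2))

theorem aa_pos (i : ℕ) : 0 < aa i := by unfold aa; positivity

theorem cc_pos (i : ℕ) : 0 < cc i := by have := aa_pos i; unfold cc; positivity

theorem aa_succ (i : ℕ) : aa (i + 1) = aa i * ((2 * i + 1) / (2 * i + 2)) := by
  unfold aa
  rw [show 2 * (i + 1) = 2 * i + 1 + 1 by ring, Nat.factorial_succ, Nat.factorial_succ,
    Nat.factorial_succ]
  push_cast
  field_simp
  ring

theorem aa_sq (i : ℕ) : aa i ^ 2 * (3 * i + 1) ≤ 1 := by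
  induction i with
  | zero => simp [aa]
  | succ n ih =>
    rw [aa_succ]
    push_cast
    refine le_trans ?_ ih
    rw [mul_pow, mul_assoc]
    refine mul_le_mul_of_nonneg_left ?_ (sq_nonneg _)
    rw [div_pow, div_mul_eq_mul_div, div_le_iff₀ (by positivity)]
    have : (0:ℝ) ≤ n := Nat.cast_nonneg n
    nlinarith

theorem aa_choose (n : ℕ) : Ring.choose ((1/2 : ℝ) + n - 1) n = aa n := by
  rw [← Ring.multichoose_eq]
  have key : ∀ n : ℕ, (Polynomial.smeval (ascPochhammer ℕ n) (1/2 : ℝ)) = n.factorial * aa n := by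
    intro n
    induction n with
    | zero => simp [aa]
    | succ k ih =>
      rw [ascPochhammer_succ_right, Polynomial.smeval_mul, ih, aa_succ, Nat.factorial_succ]
      simp [Polynomial.smeval_add, Polynomial.smeval_natCast]
      field_simp
      ring
  have h := Ring.factorial_nsmul_multichoose_eq_ascPochhammer (1/2 : ℝ) n
  rw [key, nsmul_eq_mul] at h
  exact mul_left_cancel₀ (by positivity) h

theorem aa_hasSum (x : ℝ) (h0 : 0 ≤ x) (h1 : x < 1) :
    HasSum (fun n => aa n * x ^ n) (1 / √(1 - x)) := by
  have := (Real.one_div_one_sub_rpow_hasFPowerSeriesOnBall_zero (1/2)).hasSum_sub (y := x) (by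
    simp [edist_eq_enorm_sub, enorm_eq_nnnorm]
    rw [← NNReal.coe_lt_coe]; simpa [abs_of_nonneg h0] using h1)
  simp only [← Real.sqrt_eq_rpow] at this
  simpa [aa_choose, FormalMultilinearSeries.ofScalars, mul_comm, aa_choose, -one_div] using this

noncomputable def DD (N : ℕ) (x : ℝ) : ℝ := 1 / √(1 - x) - ∑ i ∈ Finset.range N, aa i * x ^ i

theorem DD_hasSum (N : ℕ) (x : ℝ) (h0 : 0 ≤ x) (h1 : x < 1) :
    HasSum (fun n => aa (n + N) * x ^ (n + N)) (DD N x) :=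
  (hasSum_nat_add_iff' (f := fun n => aa n * x ^ n) N).2 (aa_hasSum x h0 h1)

theorem DD_nonneg (N : ℕ) (x : ℝ) (h0 : 0 ≤ x) (h1 : x < 1) : 0 ≤ DD N x :=
  (DD_hasSum N x h0 h1).nonneg fun n => mul_nonneg (aa_pos _).le (pow_nonneg h0 _)

theorem DD_mono (N : ℕ) (x y : ℝ) (h0 : 0 ≤ x) (hxy : x ≤ y) (h1 : y < 1) : DD N x ≤ DD N y :=
  hasSum_le (fun n => mul_le_mul_of_nonneg_left (pow_le_pow_left₀ h0 hxy _) (aa_pos _).le)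
    (DD_hasSum N x h0 (hxy.trans_lt h1)) (DD_hasSum N y (h0.trans hxy) h1)

theorem DD_tendsto (x : ℝ) (h0 : 0 ≤ x) (h1 : x < 1) :
    Filter.Tendsto (fun N => DD N x) Filter.atTop (nhds 0) := by
  have := (aa_hasSum x h0 h1).tendsto_sum_nat.const_sub (1 / √(1 - x))
  simpa [DD] using this

noncomputable def ff (t : ℝ) : ℝ := √(1 - t ^ 2) + t * Real.arcsin t - 1
noncomputable def SS (N : ℕ) (t : ℝ) : ℝ := ∑ i ∈ Finset.range N, cc i * t ^ (2 * i + 2)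
noncomputable def SS' (N : ℕ) (t : ℝ) : ℝ :=
  ∑ i ∈ Finset.range N, (aa i / (2 * i + 1)) * t ^ (2 * i + 1)

theorem ff_deriv (t : ℝ) (h0 : 0 ≤ t) (h1 : t < 1) : HasDerivAt ff (Real.arcsin t) t := by
  have hp : 0 < 1 - t ^ 2 := by nlinarith
  have e1 : HasDerivAt (fun t : ℝ => 1 - t ^ 2) (-(2 * t)) t := by
    simpa using ((hasDerivAt_pow 2 t).const_sub 1)
  have e2 := e1.sqrt hp.ne'
  have e3 := (hasDerivAt_id t).mul (Real.hasDerivAt_arcsin (x := t) (by linarith) h1.ne)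
  have := (e2.add e3).sub_const 1
  refine this.congr_deriv ?_
  have : √(1 - t ^ 2) ≠ 0 := (Real.sqrt_pos.2 hp).ne'
  simp only [id]
  field_simp
  ring

theorem SS_deriv (N : ℕ) (t : ℝ) : HasDerivAt (SS N) (SS' N t) t := by
  unfold SS SS'
  refine HasDerivAt.fun_sum fun i _ => ?_
  refine ((hasDerivAt_pow (2 * i + 2) t).const_mul (cc i)).congr_deriv ?_
  unfold cc
  push_cast
  field_simp

theorem SS'_deriv (N : ℕ) (t : ℝ) :
    HasDerivAt (SS' N) (∑ i ∈ Finset.range N, aa i * (t ^ 2) ^ i) t := by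
  unfold SS'
  refine HasDerivAt.fun_sum fun i _ => ?_
  refine ((hasDerivAt_pow (2 * i + 1) t).const_mul (aa i / (2 * i + 1))).congr_deriv ?_
  push_cast
  rw [← pow_mul]
  field_simp

theorem FF_bound (N : ℕ) (r : ℝ) (h0 : 0 ≤ r) (h1 : r < 1) :
    0 ≤ ff r - SS N r ∧ ff r - SS N r ≤ DD N (r ^ 2) := by
  have hr2 : r ^ 2 < 1 := by nlinarith
  have hD := DD_nonneg N (r ^ 2) (sq_nonneg _) hr2
  have s1 := aux_mvt (fun t => Real.arcsin t - SS' N t) (fun t => DD N (t ^ 2)) r (DD N (r ^ 2))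
    (fun t ht => by
      have := (Real.hasDerivAt_arcsin (x := t) (by linarith [ht.1])
        (by linarith [ht.2])).sub (SS'_deriv N t)
      exact this)
    (by simp [SS'])
    (fun t ht => by
      have : t ^ 2 ≤ r ^ 2 := pow_le_pow_left₀ ht.1 ht.2 2
      exact ⟨DD_nonneg N _ (sq_nonneg _) (by linarith),
        DD_mono N _ _ (sq_nonneg _) this hr2⟩)
  have s2 := aux_mvt (fun t => ff t - SS N t) (fun t => Real.arcsin t - SS' N t) r (DD N (r ^ 2))
    (fun t ht => (ff_deriv t ht.1 (by linarith [ht.2])).sub (SS_deriv N t))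
    (by simp [SS, ff])
    (fun t ht => by
      obtain ⟨a, b⟩ := s1 t ht
      refine ⟨a, b.trans ?_⟩
      nlinarith [ht.1, ht.2]) r ⟨h0, le_rfl⟩
  refine ⟨s2.1, s2.2.trans ?_⟩
  nlinarith

theorem SS_tendsto (r : ℝ) (h0 : 0 ≤ r) (h1 : r < 1) :
    Filter.Tendsto (fun N => SS N r) Filter.atTop (nhds (ff r)) := by
  have hr2 : r ^ 2 < 1 := by nlinarith
  have := squeeze_zero (fun N => (FF_bound N r h0 h1).1) (fun N => (FF_bound N r h0 h1).2)
    (DD_tendsto (r ^ 2) (sq_nonneg _) hr2)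
  simpa using this.const_sub (ff r)

theorem cc_le (p : ℕ) (hp : 1 ≤ p) :
    cc (p + 1) ≤ aa p / (6 * p) - aa (p + 1) / (6 * (p + 1 : ℕ)) := by
  unfold cc
  rw [aa_succ]
  have hp' : (1:ℝ) ≤ p := by exact_mod_cast hp
  have ha := aa_pos p
  have : aa p / (6 * p) - aa p * ((2 * p + 1) / (2 * p + 2)) / (6 * (p + 1 : ℕ)) -
    aa p * ((2 * p + 1) / (2 * p + 2)) / ((2 * (p + 1 : ℕ) + 1) * (2 * (p + 1 : ℕ) + 2))
    = aa p * ((3 * p + 2) * (2 * p + 3) * (p + 2) - 3 * p * (p + 1) * (2 * p + 1)) /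
      (12 * p * (p + 1) ^ 2 * (2 * p + 3) * (p + 2)) := by
    push_cast
    field_simp
    ring
  have h2 : 0 ≤ aa p * ((3 * p + 2) * (2 * p + 3) * (p + 2) - 3 * p * (p + 1) * (2 * p + 1)) /
      (12 * p * (p + 1) ^ 2 * (2 * p + 3) * (p + 2)) := by
    refine div_nonneg (mul_nonneg ha.le ?_) (by positivity)
    ring_nf
    positivity
  linarith

theorem SS_tail (p : ℕ) (hp : 1 ≤ p) (r : ℝ) (h0 : 0 ≤ r) (h1 : r ≤ 1) (k : ℕ) :
    SS (p + 1 + k) r ≤ SS (p + 1) r + aa p / (6 * p) - aa (p + k) / (6 * (p + k : ℕ)) := by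
  induction k with
  | zero => simp
  | succ k ih =>
    have e : SS (p + 1 + (k + 1)) r = SS (p + 1 + k) r + cc (p + k + 1) * r ^ (2 * (p + k + 1) + 2) := by
      unfold SS
      rw [show p + 1 + (k + 1) = p + 1 + k + 1 by ring, Finset.sum_range_succ,
        show p + 1 + k = p + k + 1 by ring]
    have h2 := cc_le (p + k) (by omega)
    have h3 : cc (p + k + 1) * r ^ (2 * (p + k + 1) + 2) ≤ cc (p + k + 1) :=
      mul_le_of_le_one_right (cc_pos _).le (pow_le_one₀ h0 h1)
    rw [e, ← add_assoc]
    linarith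

theorem ff_bound (p : ℕ) (hp : 1 ≤ p) (r : ℝ) (h0 : 0 ≤ r) (h1 : r < 1) :
    |SS (p + 1) r - ff r| ≤ aa p / (6 * p) := by
  have hl := (FF_bound (p + 1) r h0 h1).1
  have hu : ff r ≤ SS (p + 1) r + aa p / (6 * p) := by
    refine le_of_tendsto ((Filter.tendsto_add_atTop_iff_nat (p + 1)).2 (SS_tendsto r h0 h1))
      (Filter.Eventually.of_forall fun k => ?_)
    have := SS_tail p hp r h0 h1.le k
    have h3 : 0 ≤ aa (p + k) / (6 * (p + k : ℕ)) :=
      div_nonneg (aa_pos _).le (by positivity)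
    rw [add_comm k]
    linarith
  have := aa_pos p
  rw [abs_le]
  constructor
  · linarith
  · have : 0 ≤ aa p / (6 * p) := by positivity
    linarith

theorem ff_bound_all (p : ℕ) (hp : 1 ≤ p) (r : ℝ) (hr : r ∈ Set.Icc (-1 : ℝ) 1) :
    |SS (p + 1) r - ff r| ≤ aa p / (6 * p) := by
  have hcont : Continuous (fun r => |SS (p + 1) r - ff r|) := by
    unfold SS ff
    have := Real.continuous_arcsin
    fun_prop
  have hpos : ∀ r ∈ Set.Icc (0:ℝ) 1, |SS (p + 1) r - ff r| ≤ aa p / (6 * p) := by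
    have hs : Set.Ico (0:ℝ) 1 ⊆ {r | |SS (p + 1) r - ff r| ≤ aa p / (6 * p)} :=
      fun r hr => ff_bound p hp r hr.1 hr.2
    have := closure_minimal hs (isClosed_le hcont continuous_const)
    rw [closure_Ico (by norm_num)] at this
    exact this
  rcases le_total 0 r with h | h
  · exact hpos r ⟨h, hr.2⟩
  · have := hpos (-r) ⟨by linarith, by linarith [hr.1]⟩
    have e1 : SS (p + 1) (-r) = SS (p + 1) r := by
      unfold SS
      refine Finset.sum_congr rfl fun i _ => ?_
      rw [Even.neg_pow ⟨i + 1, by ring⟩]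
    have e2 : ff (-r) = ff r := by simp [ff, Real.arcsin_neg]
    rwa [e1, e2] at this

theorem prelu_approx_kappa1 (ε : ℝ) (hε : 0 < ε) (p : ℕ)
    (hp : 1 / (9 * ε ^ ((2 : ℝ) / 3)) ≤ (p : ℝ)) :
    ∀ α ∈ Set.Icc (-1 : ℝ) 1, |Prelu p α - kappa1 α| ≤ ε := by
  intro α hα
  have hpi := Real.pi_gt_three
  set y := ε ^ ((1 : ℝ) / 3) with hy
  have hy0 : 0 < y := by positivity
  have hy3 : y ^ 3 = ε := by
    rw [hy, ← Real.rpow_natCast, ← Real.rpow_mul hε.le]; norm_num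
  have hy2 : y ^ 2 = ε ^ ((2 : ℝ) / 3) := by
    rw [hy, ← Real.rpow_natCast, ← Real.rpow_mul hε.le]; norm_num
  rw [← hy2] at hp
  have hp0 : (0:ℝ) < p := lt_of_lt_of_le (by positivity) hp
  have hp1 : 1 ≤ p := by exact_mod_cast hp0
  rw [div_le_iff₀ (by positivity)] at hp
  have e : Prelu p α - kappa1 α = (1 / Real.pi) * (SS (p + 1) α - ff α) := by
    have : SS (p + 1) α = ∑ i ∈ Finset.range (p + 1),
      (Nat.factorial (2 * i) : ℝ) * α ^ (2 * i + 2) /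
        (2 ^ (2 * i) * ((Nat.factorial i : ℝ)) ^ 2 * (2 * i + 1) * (2 * i + 2)) := by
      unfold SS cc aa
      refine Finset.sum_congr rfl fun i _ => ?_
      field_simp
    unfold Prelu kappa1 ff
    rw [← this, Real.arccos]
    field_simp
    ring
  rw [e, abs_mul, abs_of_pos (by positivity : 0 < 1 / Real.pi)]
  have hb := ff_bound_all p hp1 α hα
  have ha := aa_pos p
  have hsq := aa_sq p
  -- a ≤ 6 p π ε
  have h1 : aa p ≤ 18 * p * y ^ 3 := by
    rw [← sq_le_sq₀ ha.le (by positivity)]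
    have hq : 1 ≤ (p * (9 * y ^ 2)) ^ 3 := one_le_pow₀ hp
    have h3 : (3 * p) * aa p ^ 2 ≤ (3 * p) * (243 * p ^ 2 * y ^ 6) := by
      nlinarith [sq_nonneg (aa p)]
    have h4 := le_of_mul_le_mul_left h3 (by positivity)
    have h5 : 0 ≤ (p : ℝ) ^ 2 * y ^ 6 := by positivity
    nlinarith
  have h2 : aa p / (6 * p) ≤ 3 * ε := by
    rw [div_le_iff₀ (by positivity), ← hy3]; linarith
  calc 1 / Real.pi * |SS (p + 1) α - ff α| ≤ 1 / Real.pi * (3 * ε) := by gcongr; linarith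
    _ ≤ ε := by
      rw [div_mul_eq_mul_div, div_le_iff₀ (by positivity)]; nlinarith
end

section
/- For every integer p ≥ 3, every α ∈ [−1,1] and every α' ∈ ℝ with |α − α'| ≤ 1/(6p), the polynomial Ṗ_relu^(p)(α) := 1/2 + (1/π)·Σ_{i=0}^{p} (2i)!·α^{2i+1} / (2^{2i}·(i!)²·(2i+1)) satisfies |Ṗ_relu^(p)(α) − Ṗ_relu^(p)(α')| ≤ √p · |α − α'|. -/
/-- the truncated Taylor polynomial `Ṗ_relu^(p)` approximating `κ0`. -/
noncomputable def PdotRelu (p : ℕ) (α : ℝ) : ℝ :=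
  1 / 2 +
    (1 / Real.pi) * ∑ i ∈ Finset.range (p + 1),
      (Nat.factorial (2 * i) : ℝ) * α ^ (2 * i + 1) /
        (2 ^ (2 * i) * ((Nat.factorial i : ℝ)) ^ 2 * (2 * i + 1))

/-- the coefficients of the derivative -/
noncomputable def pdrC (i : ℕ) : ℝ :=
  (Nat.factorial (2 * i) : ℝ) / (2 ^ (2 * i) * ((Nat.factorial i : ℝ)) ^ 2)

lemma pdrC_pos (i : ℕ) : 0 < pdrC i := by
  unfold pdrC; positivity

lemma pdrC_succ (i : ℕ) : pdrC (i + 1) = pdrC i * ((2 * i + 1) / (2 * i + 2)) := by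
  unfold pdrC
  have h : 2 * (i + 1) = 2 * i + 1 + 1 := by ring
  rw [h, Nat.factorial_succ, Nat.factorial_succ, Nat.factorial_succ]
  push_cast
  have := Nat.factorial_pos i
  field_simp
  ring

lemma pdrC_sum (p : ℕ) : ∑ i ∈ Finset.range (p + 1), pdrC i = (2 * p + 1) * pdrC p := by
  induction p with
  | zero => simp
  | succ n ih =>
    rw [Finset.sum_range_succ, ih, pdrC_succ]
    push_cast
    field_simp

lemma pdrC_sq (p : ℕ) : (2 * p + 1) * pdrC p ^ 2 ≤ 1 := by
  induction p with
  | zero => simp [pdrC]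
  | succ n ih =>
    rw [pdrC_succ]
    refine le_trans ?_ ih
    have h : ((2 * ((n + 1 : ℕ) : ℝ) + 1)) * ((2 * n + 1) / (2 * n + 2)) ^ 2 ≤ 2 * n + 1 := by
      push_cast
      rw [div_pow, mul_div_assoc', div_le_iff₀ (by positivity)]
      have : (0 : ℝ) ≤ n := Nat.cast_nonneg n
      nlinarith
    calc _ = ((2 * ((n + 1 : ℕ) : ℝ) + 1)) * ((2 * n + 1) / (2 * n + 2)) ^ 2 * pdrC n ^ 2 := by ring
      _ ≤ _ := mul_le_mul_of_nonneg_right h (sq_nonneg _)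

lemma pdr_sum_le (p : ℕ) (hp : 1 ≤ p) :
    ∑ i ∈ Finset.range (p + 1), pdrC i ≤ 2 * Real.sqrt p := by
  rw [pdrC_sum]
  have hp' : (1 : ℝ) ≤ p := by exact_mod_cast hp
  apply le_of_sq_le_sq _ (by positivity)
  rw [mul_pow, mul_pow, Real.sq_sqrt (by positivity)]
  nlinarith [pdrC_sq p]

lemma pdr_pow_le (p i : ℕ) (hp : 1 ≤ p) (hi : i ≤ p) (x : ℝ) (hx : |x| ≤ 1 + 1 / (6 * (p : ℝ))) :
    |x ^ (2 * i)| ≤ 3 / 2 := by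
  have hp' : (1 : ℝ) ≤ p := by exact_mod_cast hp
  have h1 : (1 : ℝ) ≤ 1 + 1 / (6 * (p : ℝ)) := by
    have : 0 ≤ 1 / (6 * (p : ℝ)) := by positivity
    linarith
  have h2 : 1 + 1 / (6 * (p : ℝ)) ≤ Real.exp (1 / (6 * (p : ℝ))) := by
    linarith [Real.add_one_le_exp (1 / (6 * (p : ℝ)))]
  rw [abs_pow]
  calc |x| ^ (2 * i) ≤ (1 + 1 / (6 * (p : ℝ))) ^ (2 * i) := by gcongr
    _ ≤ (1 + 1 / (6 * (p : ℝ))) ^ (2 * p) := pow_le_pow_right₀ h1 (by omega)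
    _ ≤ Real.exp (1 / (6 * (p : ℝ))) ^ (2 * p) := by gcongr
    _ = Real.exp (1 / 3) := by
      rw [← Real.exp_nat_mul]; congr 1; push_cast; field_simp; norm_num
    _ ≤ 3 / 2 := by
      apply le_of_pow_le_pow_left₀ (n := 3) (by norm_num) (by norm_num)
      rw [← Real.exp_nat_mul]
      norm_num
      linarith [Real.exp_one_lt_d9]

lemma pdr_deriv (p : ℕ) (x : ℝ) :
    HasDerivAt (PdotRelu p)
      ((1 / Real.pi) * ∑ i ∈ Finset.range (p + 1), pdrC i * x ^ (2 * i)) x := by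
  unfold PdotRelu
  refine HasDerivAt.const_add _ (HasDerivAt.const_mul _ (HasDerivAt.fun_sum fun i _ => ?_))
  have h := (((hasDerivAt_pow (2 * i + 1) x).const_mul (Nat.factorial (2 * i) : ℝ)).div_const
    (2 ^ (2 * i) * ((Nat.factorial i : ℝ)) ^ 2 * (2 * i + 1)))
  refine h.congr_deriv ?_
  have := Nat.factorial_pos i
  unfold pdrC
  push_cast
  field_simp

theorem pdotrelu_sensitivity (p : ℕ) (hp : 3 ≤ p) (α α' : ℝ)
    (hα : α ∈ Set.Icc (-1 : ℝ) 1) (hαα' : |α - α'| ≤ 1 / (6 * (p : ℝ))) :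
    |PdotRelu p α - PdotRelu p α'| ≤ Real.sqrt p * |α - α'| := by
  have hp1 : 1 ≤ p := by omega
  have hd : 0 ≤ 1 / (6 * (p : ℝ)) := by positivity
  obtain ⟨h1, h2⟩ := hα
  obtain ⟨h3, h4⟩ := abs_le.mp hαα'
  refine (convex_Icc (-(1 + 1 / (6 * (p : ℝ)))) (1 + 1 / (6 * (p : ℝ)))).norm_image_sub_le_of_norm_hasDerivWithin_le
    (f := PdotRelu p) (fun x _ => (pdr_deriv p x).hasDerivWithinAt) ?_
    ⟨by linarith, by linarith⟩ ⟨by linarith, by linarith⟩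
  intro x hx
  have hx' := abs_le.mpr hx
  rw [Real.norm_eq_abs, abs_mul, abs_of_pos (by positivity : 0 < 1 / Real.pi), one_div_mul_eq_div,
    div_le_iff₀ Real.pi_pos]
  calc _ ≤ ∑ i ∈ Finset.range (p + 1), |pdrC i * x ^ (2 * i)| := Finset.abs_sum_le_sum_abs _ _
    _ ≤ ∑ i ∈ Finset.range (p + 1), pdrC i * (3 / 2) := by
      refine Finset.sum_le_sum fun i hi => ?_
      rw [abs_mul, abs_of_pos (pdrC_pos i)]
      exact mul_le_mul_of_nonneg_left
        (pdr_pow_le p i hp1 (by have := Finset.mem_range.mp hi; omega) x hx') (pdrC_pos i).le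
    _ = (∑ i ∈ Finset.range (p + 1), pdrC i) * (3 / 2) := by rw [Finset.sum_mul]
    _ ≤ (2 * Real.sqrt p) * (3 / 2) := by
      exact mul_le_mul_of_nonneg_right (pdr_sum_le p hp1) (by norm_num)
    _ = Real.sqrt p * 3 := by ring
    _ ≤ _ := mul_le_mul_of_nonneg_left Real.pi_gt_three.le (Real.sqrt_nonneg _)
end

section
/- Let X = [x1,…,xn] ∈ ℝ^{d×n} have nonzero columns, let K0 ∈ ℝ^{n×n} be the zeroth-order arc-cosine kernel matrix of X, let W ∈ ℝ^{m×d} be a random matrix with i.i.d. standard normal entries, and set Φ0 := √(2/m)·Step(W X) ∈ ℝ^{m×n} where Step is applied entrywise. Let λ ∈ (0, ‖K0‖₂) and let s_λ := tr(K0·(K0 + λI)⁻¹). For every ε ∈ (0,1/2) and δ ∈ (0,1), if m ≥ (8/3)·(n/(λ·ε²))·log(16·s_λ/δ), then with probability at least 1 − δ over the draw of W: (1 − ε)(K0 + λI) ⪯ Φ0ᵀΦ0 + λI ⪯ (1 + ε)(K0 + λI). -/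
open MeasureTheory ProbabilityTheory Matrix

noncomputable def kappa0 (α : ℝ) : ℝ := (1 / Real.pi) * (Real.pi - Real.arccos α)

/-- The ℓ₂ norm of the `i`-th column of `X`. -/
noncomputable def colNorm {d n : ℕ} (X : Matrix (Fin d) (Fin n) ℝ) (i : Fin n) : ℝ :=
  Real.sqrt (∑ k, X k i ^ 2)

/-- The inner product of the `i`-th and `j`-th columns of `X`. -/
noncomputable def colInner {d n : ℕ} (X : Matrix (Fin d) (Fin n) ℝ) (i j : Fin n) : ℝ :=
  ∑ k, X k i * X k j

/-- The zeroth-order arc-cosine kernel matrix `K0` of the dataset `X`. -/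
noncomputable def K0mat {d n : ℕ} (X : Matrix (Fin d) (Fin n) ℝ) :
    Matrix (Fin n) (Fin n) ℝ :=
  Matrix.of fun i j => kappa0 (colInner X i j / (colNorm X i * colNorm X j))

/-- The first-order arc-cosine kernel matrix `K1` of the dataset `X`. -/
noncomputable def K1mat {d n : ℕ} (X : Matrix (Fin d) (Fin n) ℝ) :
    Matrix (Fin n) (Fin n) ℝ :=
  Matrix.of fun i j =>
    colNorm X i * colNorm X j * kappa1 (colInner X i j / (colNorm X i * colNorm X j))

/-- The two-layered ReLU NTK kernel matrix `K_ntk = K1 + K0 ⊙ (Xᵀ X)`. -/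
noncomputable def KntkMat {d n : ℕ} (X : Matrix (Fin d) (Fin n) ℝ) :
    Matrix (Fin n) (Fin n) ℝ :=
  K1mat X + Matrix.hadamard (K0mat X) (Xᵀ * X)

/-- The ℓ₂ operator (spectral) norm of a matrix. -/
noncomputable def l2OpNorm {d n : ℕ} (X : Matrix (Fin d) (Fin n) ℝ) : ℝ :=
  ‖LinearMap.toContinuousLinearMap (Matrix.toEuclideanLin X)‖

/-- The statistical dimension `s_λ(K) = tr(K (K + λ I)⁻¹)`. -/
noncomputable def statDim {n : ℕ} (K : Matrix (Fin n) (Fin n) ℝ) (lam : ℝ) : ℝ :=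
  (K * (K + lam • (1 : Matrix (Fin n) (Fin n) ℝ))⁻¹).trace

/-- `A ⪯ B` in the Loewner order. -/
def Loewner {n : ℕ} (A B : Matrix (Fin n) (Fin n) ℝ) : Prop := (B - A).PosSemidef

noncomputable def step (t : ℝ) : ℝ := if 0 < t then 1 else 0

noncomputable def relu (t : ℝ) : ℝ := max t 0

/-- The distribution of an `m × d` matrix with i.i.d. standard normal entries. -/
noncomputable def gaussMat (m d : ℕ) : Measure (Fin m → Fin d → ℝ) :=
  Measure.pi fun _ => Measure.pi fun _ => gaussianReal 0 1

/-- The zeroth-order arc-cosine random features `Φ0 = √(2/m) · Step(W X)`. -/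
noncomputable def Phi0 {d n : ℕ} (X : Matrix (Fin d) (Fin n) ℝ) (m : ℕ)
    (W : Fin m → Fin d → ℝ) : Matrix (Fin m) (Fin n) ℝ :=
  Matrix.of fun r i => Real.sqrt (2 / (m : ℝ)) * step (∑ k, W r k * X k i)


section LiebPart
variable {ι : Type*} [Fintype ι] [DecidableEq ι]

/-- orthogonal diagonalisation data -/
structure IsRep (A V : Matrix ι ι ℝ) (p : ι → ℝ) : Prop where
  h1 : Vᵀ * V = 1
  h2 : V * Vᵀ = 1
  eq : A = V * diagonal p * Vᵀ

lemma exists_rep {A : Matrix ι ι ℝ} (hA : A.IsHermitian) : ∃ V p, IsRep A V p := by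
  refine ⟨hA.eigenvectorUnitary, hA.eigenvalues, ?_, ?_, ?_⟩
  · have := Unitary.star_mul_self_of_mem hA.eigenvectorUnitary.2
    simpa [star_eq_conjTranspose] using this
  · have := Unitary.mul_star_self_of_mem hA.eigenvectorUnitary.2
    simpa [star_eq_conjTranspose] using this
  · have := hA.spectral_theorem
    rw [Unitary.conjStarAlgAut_apply] at this
    conv_lhs => rw [this]
    simp [star_eq_conjTranspose]

lemma IsRep.isHermitian {A V : Matrix ι ι ℝ} {p : ι → ℝ} (h : IsRep A V p) : A.IsHermitian := by
  rw [h.eq, Matrix.IsHermitian]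
  simp [Matrix.conjTranspose_eq_transpose_of_trivial, Matrix.transpose_mul, Matrix.mul_assoc]

lemma IsRep.exp {A V : Matrix ι ι ℝ} {p : ι → ℝ} (h : IsRep A V p) :
    IsRep (NormedSpace.exp A) V (fun i => Real.exp (p i)) := by
  refine ⟨h.h1, h.h2, ?_⟩
  have hV : V⁻¹ = Vᵀ := Matrix.inv_eq_right_inv h.h2
  have hu : IsUnit V := ⟨⟨V, Vᵀ, h.h2, h.h1⟩, rfl⟩
  have := Matrix.exp_conj V (diagonal p) hu
  rw [hV, ← h.eq, Matrix.exp_diagonal] at this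
  rw [this]
  congr 3
  ext i
  rw [Pi.coe_exp, Real.exp_eq_exp_ℝ]

lemma IsRep.trace {A V : Matrix ι ι ℝ} {p : ι → ℝ} (h : IsRep A V p) : A.trace = ∑ i, p i := by
  rw [h.eq, Matrix.trace_mul_comm, ← Matrix.mul_assoc, h.h1, Matrix.one_mul, Matrix.trace_diagonal]

lemma trace_uv (U Q : Matrix ι ι ℝ) (f g : ι → ℝ) :
    (diagonal f * U * diagonal g * Qᵀ).trace = ∑ a, ∑ b, f a * g b * (U a b * Q a b) := by
  simp only [Matrix.trace, Matrix.diag, Matrix.mul_apply (N := Qᵀ), Matrix.mul_diagonal,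
    Matrix.diagonal_mul, Matrix.transpose_apply]
  refine Finset.sum_congr rfl fun a _ => Finset.sum_congr rfl fun b _ => by ring

lemma trace_two {A V B Y : Matrix ι ι ℝ} {p q : ι → ℝ} (hA : IsRep A V p) (hB : IsRep B Y q) :
    (A * B).trace = ∑ a, ∑ b, p a * q b * ((Vᵀ * Y) a b) ^ 2 := by
  have : (A * B).trace = (diagonal p * (Vᵀ * Y) * diagonal q * (Vᵀ * Y)ᵀ).trace := by
    rw [hA.eq, hB.eq, Matrix.transpose_mul, Matrix.transpose_transpose]
    simp only [Matrix.mul_assoc]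
    rw [Matrix.trace_mul_comm]
    simp only [Matrix.mul_assoc]
  rw [this, trace_uv]
  simp only [sq]

lemma rowsum {A V B Y : Matrix ι ι ℝ} {p q : ι → ℝ} (hA : IsRep A V p) (hB : IsRep B Y q) (a : ι) :
    ∑ b, ((Vᵀ * Y) a b) ^ 2 = 1 := by
  have : ((Vᵀ * Y) * (Vᵀ * Y)ᵀ) a a = 1 := by
    rw [Matrix.transpose_mul, Matrix.transpose_transpose, Matrix.mul_assoc, ← Matrix.mul_assoc Y,
      hB.h2, Matrix.one_mul, hA.h1, Matrix.one_apply_eq]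
  rw [← this, Matrix.mul_apply]
  simp [sq]

lemma colsum {A V B Y : Matrix ι ι ℝ} {p q : ι → ℝ} (hA : IsRep A V p) (hB : IsRep B Y q) (b : ι) :
    ∑ a, ((Vᵀ * Y) a b) ^ 2 = 1 := by
  have : ((Vᵀ * Y)ᵀ * (Vᵀ * Y)) b b = 1 := by
    rw [Matrix.transpose_mul, Matrix.transpose_transpose, Matrix.mul_assoc, ← Matrix.mul_assoc V,
      hA.h2, Matrix.one_mul, hB.h1, Matrix.one_apply_eq]
  rw [← this, Matrix.mul_apply]
  simp [sq]

lemma trace_left {A V B Y : Matrix ι ι ℝ} {p q : ι → ℝ} (hA : IsRep A V p) (hB : IsRep B Y q)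
    (f : ι → ℝ) : ∑ a, f a = ∑ a, ∑ b, f a * ((Vᵀ * Y) a b) ^ 2 := by
  refine Finset.sum_congr rfl fun a _ => ?_
  rw [← Finset.mul_sum, rowsum hA hB, mul_one]

lemma trace_right {A V B Y : Matrix ι ι ℝ} {p q : ι → ℝ} (hA : IsRep A V p) (hB : IsRep B Y q)
    (f : ι → ℝ) : ∑ b, f b = ∑ a, ∑ b, f b * ((Vᵀ * Y) a b) ^ 2 := by
  rw [Finset.sum_comm]
  refine Finset.sum_congr rfl fun a _ => ?_
  rw [← Finset.mul_sum, colsum hA hB, mul_one]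

lemma rep_self_mul {A B V : Matrix ι ι ℝ} {p q : ι → ℝ} (hA : IsRep A V p) (hB : IsRep B V q) :
    IsRep (A * B) V (fun i => p i * q i) := by
  refine ⟨hA.h1, hA.h2, ?_⟩
  rw [hA.eq, hB.eq, ← Matrix.diagonal_mul_diagonal]
  calc _ = V * diagonal p * (Vᵀ * V) * diagonal q * Vᵀ := by simp only [Matrix.mul_assoc]
    _ = _ := by rw [hA.h1]; simp only [Matrix.mul_assoc, Matrix.one_mul]

/-- Klein's inequality for exp. -/
lemma klein {P Q : Matrix ι ι ℝ} (hP : P.IsHermitian) (hQ : Q.IsHermitian) :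
    (NormedSpace.exp P).trace + (NormedSpace.exp P * (Q - P)).trace
      ≤ (NormedSpace.exp Q).trace := by
  obtain ⟨V, p, hp⟩ := exists_rep hP
  obtain ⟨Y, q, hq⟩ := exists_rep hQ
  rw [Matrix.mul_sub, Matrix.trace_sub, trace_two hp.exp hq, hp.exp.trace, hq.exp.trace,
    (rep_self_mul hp.exp hp).trace, trace_left hp hq (fun i => Real.exp (p i)),
    trace_left hp hq (fun i => Real.exp (p i) * p i),
    trace_right hp hq (fun i => Real.exp (q i)), ← Finset.sum_sub_distrib, ← Finset.sum_add_distrib]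
  refine Finset.sum_le_sum (fun a _ => ?_)
  rw [← Finset.sum_sub_distrib, ← Finset.sum_add_distrib]
  refine Finset.sum_le_sum fun b _ => ?_
  have h1 : Real.exp (p a) * (1 + (q b - p a)) ≤ Real.exp (q b) := by
    have := Real.add_one_le_exp (q b - p a)
    calc _ ≤ Real.exp (p a) * Real.exp (q b - p a) := mul_le_mul_of_nonneg_left (by linarith) (Real.exp_pos _).le
      _ = _ := by rw [← Real.exp_add]; ring_nf
  nlinarith [mul_le_mul_of_nonneg_right h1 (sq_nonneg ((Vᵀ * Y) a b))]

/-- the variational functional -/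
noncomputable def varF (T A : Matrix ι ι ℝ) (t : ℝ) (U : Matrix ι ι ℝ) : ℝ :=
  2 * (T * Uᵀ).trace - (U * A * Uᵀ).trace - t * (T * U * Uᵀ).trace

noncomputable def optF (V Y : Matrix ι ι ℝ) (τ α : ι → ℝ) (t : ℝ) : ℝ :=
  ∑ a, ∑ b, (τ a ^ 2 / (α b + t * τ a)) * ((Vᵀ * Y) a b) ^ 2

lemma varF_eq {T V A Y : Matrix ι ι ℝ} {τ α : ι → ℝ} (hT : IsRep T V τ) (hA : IsRep A Y α)
    (t : ℝ) (u : Matrix ι ι ℝ) :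
    varF T A t (V * u * Yᵀ) =
      ∑ a, ∑ b, (2 * (τ a * (Vᵀ * Y) a b * u a b) - (α b + t * τ a) * u a b ^ 2) := by
  have e1 : (T * (V * u * Yᵀ)ᵀ).trace = ∑ a, ∑ b, τ a * ((Vᵀ * Y) a b * u a b) := by
    have := trace_uv (Vᵀ * Y) u τ (fun _ => 1)
    simp only [Matrix.diagonal_one, Matrix.mul_one, mul_one] at this
    rw [← this, hT.eq]
    simp only [Matrix.transpose_mul, Matrix.transpose_transpose, Matrix.mul_assoc]
    rw [Matrix.trace_mul_comm]
    simp only [Matrix.mul_assoc]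
    rw [hT.h1]
    simp
  have e2 : ((V * u * Yᵀ) * A * (V * u * Yᵀ)ᵀ).trace = ∑ a, ∑ b, α b * (u a b * u a b) := by
    have := trace_uv u u (fun _ => 1) α
    simp only [Matrix.diagonal_one, Matrix.one_mul, one_mul] at this
    rw [show (∑ a, ∑ b, α b * (u a b * u a b)) = (u * diagonal α * uᵀ).trace by rw [this], hA.eq]
    have : (V * u * Yᵀ) * (Y * diagonal α * Yᵀ) * (V * u * Yᵀ)ᵀ
        = V * (u * (Yᵀ * Y) * diagonal α * (Yᵀ * Y) * uᵀ * Vᵀ) := by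
      simp only [Matrix.transpose_mul, Matrix.transpose_transpose, Matrix.mul_assoc]
    rw [this, Matrix.trace_mul_comm, hA.h1]
    simp only [Matrix.mul_assoc, hT.h1, Matrix.mul_one, Matrix.one_mul]
  have e3 : (T * (V * u * Yᵀ) * (V * u * Yᵀ)ᵀ).trace = ∑ a, ∑ b, τ a * (u a b * u a b) := by
    have := trace_uv u u τ (fun _ => 1)
    simp only [Matrix.diagonal_one, Matrix.mul_one, mul_one] at this
    rw [← this, hT.eq]
    have : (V * diagonal τ * Vᵀ) * (V * u * Yᵀ) * (V * u * Yᵀ)ᵀ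
        = V * (diagonal τ * (Vᵀ * V) * u * (Yᵀ * Y) * uᵀ * Vᵀ) := by
      simp only [Matrix.transpose_mul, Matrix.transpose_transpose, Matrix.mul_assoc]
    rw [this, Matrix.trace_mul_comm, hA.h1]
    simp only [Matrix.mul_assoc, hT.h1, Matrix.mul_one, Matrix.one_mul]
  rw [varF, e1, e2, e3]
  simp only [Finset.mul_sum, ← Finset.sum_sub_distrib]
  refine Finset.sum_congr rfl fun a _ => Finset.sum_congr rfl fun b _ => by ring

lemma varF_le {T V A Y : Matrix ι ι ℝ} {τ α : ι → ℝ} (hT : IsRep T V τ) (hA : IsRep A Y α)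
    (hτ : ∀ i, 0 < τ i) (hα : ∀ i, 0 < α i) {t : ℝ} (ht : 0 ≤ t) (U : Matrix ι ι ℝ) :
    varF T A t U ≤ optF V Y τ α t := by
  have : U = V * (Vᵀ * U * Y) * Yᵀ := by
    calc U = (V * Vᵀ) * U * (Y * Yᵀ) := by rw [hT.h2, hA.h2]; simp
      _ = _ := by simp only [Matrix.mul_assoc]
  rw [this, varF_eq hT hA, optF]
  refine Finset.sum_le_sum fun a _ => Finset.sum_le_sum fun b _ => ?_
  generalize (Vᵀ * U * Y) a b = u
  generalize (Vᵀ * Y) a b = c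
  have hD : 0 < α b + t * τ a := by have := hτ a; have := hα b; positivity
  generalize α b + t * τ a = D at hD
  rw [div_mul_eq_mul_div, le_div_iff₀ hD]
  nlinarith [sq_nonneg (τ a * c - D * u)]

lemma varF_opt {T V A Y : Matrix ι ι ℝ} {τ α : ι → ℝ} (hT : IsRep T V τ) (hA : IsRep A Y α)
    (hτ : ∀ i, 0 < τ i) (hα : ∀ i, 0 < α i) {t : ℝ} (ht : 0 ≤ t) :
    ∃ U, varF T A t U = optF V Y τ α t := by
  refine ⟨V * (Matrix.of fun a b => τ a * (Vᵀ * Y) a b / (α b + t * τ a)) * Yᵀ, ?_⟩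
  rw [varF_eq hT hA, optF]
  refine Finset.sum_congr rfl fun a _ => Finset.sum_congr rfl fun b _ => ?_
  have hD : 0 < α b + t * τ a := by have := hτ a; have := hα b; positivity
  simp only [Matrix.of_apply]
  field_simp
  ring


lemma optF_convex {J : Type*} [Fintype J] {pr : J → ℝ} (hpr : ∀ j, 0 ≤ pr j)
    {T V A Y : Matrix ι ι ℝ} {τ α : ι → ℝ} (hT : IsRep T V τ) (hA : IsRep A Y α)
    (hτ : ∀ i, 0 < τ i) (hα : ∀ i, 0 < α i)
    {T' V' A' Y' : J → Matrix ι ι ℝ} {τ' α' : J → ι → ℝ} (hT' : ∀ j, IsRep (T' j) (V' j) (τ' j))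
    (hA' : ∀ j, IsRep (A' j) (Y' j) (α' j))
    (hτ' : ∀ j i, 0 < τ' j i) (hα' : ∀ j i, 0 < α' j i)
    (hTs : T = ∑ j, pr j • T' j) (hAs : (A - ∑ j, pr j • A' j).PosSemidef)
    {t : ℝ} (ht : 0 ≤ t) :
    optF V Y τ α t ≤ ∑ j, pr j * optF (V' j) (Y' j) (τ' j) (α' j) t := by
  obtain ⟨U, hU⟩ := varF_opt hT hA hτ hα ht
  rw [← hU]
  have h1 : varF T A t U ≤ varF T (∑ j, pr j • A' j) t U := by
    have h2 := (hAs.mul_mul_conjTranspose_same U).trace_nonneg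
    rw [Matrix.mul_sub, Matrix.sub_mul, Matrix.trace_sub,
      Matrix.conjTranspose_eq_transpose_of_trivial] at h2
    unfold varF
    linarith
  have h3 : varF T (∑ j, pr j • A' j) t U = ∑ j, pr j * varF (T' j) (A' j) t U := by
    unfold varF
    rw [hTs]
    simp only [Matrix.sum_mul, Matrix.mul_sum, Matrix.trace_sum, Finset.mul_sum,
      ← Finset.sum_sub_distrib, Matrix.smul_mul, Matrix.mul_smul, Matrix.trace_smul, smul_eq_mul]
    refine Finset.sum_congr rfl fun j _ => by ring
  refine h1.trans (h3.le.trans (Finset.sum_le_sum fun j _ => ?_))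
  exact mul_le_mul_of_nonneg_left (varF_le (hT' j) (hA' j) (hτ' j) (hα' j) ht U) (hpr j)

noncomputable def intF (V Y : Matrix ι ι ℝ) (τ α : ι → ℝ) (t : ℝ) : ℝ :=
  ∑ a, ∑ b, (τ a * (Real.log (α b + t * τ a) - Real.log (α b))) * ((Vᵀ * Y) a b) ^ 2

noncomputable def relEnt (V Y : Matrix ι ι ℝ) (τ α : ι → ℝ) : ℝ :=
  ∑ a, ∑ b, (τ a * (Real.log (τ a) - Real.log (α b))) * ((Vᵀ * Y) a b) ^ 2

lemma intF_zero (V Y : Matrix ι ι ℝ) (τ α : ι → ℝ) : intF V Y τ α 0 = 0 := by simp [intF]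

lemma intF_deriv (V Y : Matrix ι ι ℝ) {τ α : ι → ℝ} 
    (hτ : ∀ i, 0 < τ i) (hα : ∀ i, 0 < α i) {t : ℝ} (ht : 0 ≤ t) :
    HasDerivAt (intF V Y τ α) (optF V Y τ α t) t := by
  unfold intF optF
  refine HasDerivAt.fun_sum fun a _ => HasDerivAt.fun_sum fun b _ => ?_
  have hD : 0 < α b + t * τ a := by have := hτ a; have := hα b; positivity
  have h1 : HasDerivAt (fun t : ℝ => α b + t * τ a) (τ a) t := by
    simpa using ((hasDerivAt_id t).mul_const (τ a)).const_add (α b)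
  have h2 := (((h1.log hD.ne').sub_const (Real.log (α b))).const_mul (τ a)).mul_const
    (((Vᵀ * Y) a b) ^ 2)
  have e : τ a ^ 2 / (α b + t * τ a) * (Vᵀ * Y) a b ^ 2
      = τ a * (τ a / (α b + t * τ a)) * (Vᵀ * Y) a b ^ 2 := by field_simp
  rw [e]
  exact h2

lemma intF_tendsto {T V A Y : Matrix ι ι ℝ} {τ α : ι → ℝ} (hT : IsRep T V τ) (hA : IsRep A Y α)
    (hτ : ∀ i, 0 < τ i) (hα : ∀ i, 0 < α i) :
    Filter.Tendsto (fun t : ℝ => intF V Y τ α t - Real.log t * T.trace) Filter.atTop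
      (nhds (relEnt V Y τ α)) := by
  have h : (fun t : ℝ => intF V Y τ α t - Real.log t * T.trace) =ᶠ[Filter.atTop] fun t =>
      ∑ a, ∑ b, (τ a * (Real.log (α b * t⁻¹ + τ a) - Real.log (α b))) * ((Vᵀ * Y) a b) ^ 2 := by
    filter_upwards [Filter.eventually_gt_atTop 0] with t ht
    rw [hT.trace, trace_left hT hA, intF]
    simp only [Finset.mul_sum, ← Finset.sum_sub_distrib]
    refine Finset.sum_congr rfl fun a _ => Finset.sum_congr rfl fun b _ => ?_
    have e : α b + t * τ a = t * (α b * t⁻¹ + τ a) := by field_simp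
    have hD : 0 < α b * t⁻¹ + τ a := by have := hτ a; have := hα b; positivity
    rw [e, Real.log_mul ht.ne' hD.ne']
    ring
  rw [Filter.tendsto_congr' h]
  unfold relEnt
  refine tendsto_finsetSum _ fun a _ => tendsto_finset_sum _ fun b _ => ?_
  refine Filter.Tendsto.mul_const _ (Filter.Tendsto.const_mul _ (Filter.Tendsto.sub_const ?_ _))
  refine Filter.Tendsto.log ?_ (hτ a).ne'
  simpa using (tendsto_inv_atTop_zero.const_mul (α b)).add_const (τ a)

lemma relEnt_convex {J : Type*} [Fintype J] {pr : J → ℝ} (hpr : ∀ j, 0 ≤ pr j)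
    {T V A Y : Matrix ι ι ℝ} {τ α : ι → ℝ} (hT : IsRep T V τ) (hA : IsRep A Y α)
    (hτ : ∀ i, 0 < τ i) (hα : ∀ i, 0 < α i)
    {T' V' A' Y' : J → Matrix ι ι ℝ} {τ' α' : J → ι → ℝ} (hT' : ∀ j, IsRep (T' j) (V' j) (τ' j))
    (hA' : ∀ j, IsRep (A' j) (Y' j) (α' j))
    (hτ' : ∀ j i, 0 < τ' j i) (hα' : ∀ j i, 0 < α' j i)
    (hTs : T = ∑ j, pr j • T' j) (hAs : (A - ∑ j, pr j • A' j).PosSemidef) :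
    relEnt V Y τ α ≤ ∑ j, pr j * relEnt (V' j) (Y' j) (τ' j) (α' j) := by
  have hlim := tendsto_finsetSum (Finset.univ : Finset J) fun j _ =>
    (intF_tendsto (hT' j) (hA' j) (hτ' j) (hα' j)).const_mul (pr j)
  refine le_of_tendsto_of_tendsto (intF_tendsto hT hA hτ hα) hlim ?_
  filter_upwards [Filter.eventually_ge_atTop 0] with R hR
  have htr : T.trace = ∑ j, pr j * (T' j).trace := by
    rw [hTs, Matrix.trace_sum]; simp [Matrix.trace_smul]
  have key : intF V Y τ α R ≤ ∑ j, pr j * intF (V' j) (Y' j) (τ' j) (α' j) R := by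
    have hd : ∀ t : ℝ, 0 ≤ t → HasDerivAt (fun t => ∑ j, pr j * intF (V' j) (Y' j) (τ' j) (α' j) t
        - intF V Y τ α t) (∑ j, pr j * optF (V' j) (Y' j) (τ' j) (α' j) t - optF V Y τ α t) t := by
      intro t ht
      refine HasDerivAt.fun_sub (HasDerivAt.fun_sum fun j _ => ?_) (intF_deriv V Y hτ hα ht)
      exact (intF_deriv (V' j) (Y' j) (hτ' j) (hα' j) ht).const_mul _
    have hm : MonotoneOn (fun t => ∑ j, pr j * intF (V' j) (Y' j) (τ' j) (α' j) t
        - intF V Y τ α t) (Set.Ici 0) := by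
      refine monotoneOn_of_deriv_nonneg (convex_Ici 0)
        (fun t ht => (hd t ht).continuousAt.continuousWithinAt) ?_ ?_
      · intro t ht
        rw [interior_Ici] at ht
        exact (hd t (le_of_lt ht)).differentiableAt.differentiableWithinAt
      · intro t ht
        rw [interior_Ici] at ht
        rw [(hd t (le_of_lt ht)).deriv, sub_nonneg]
        exact optF_convex hpr hT hA hτ hα hT' hA' hτ' hα' hTs hAs (le_of_lt ht)
    have := hm (Set.mem_Ici.2 le_rfl) (Set.mem_Ici.2 hR) hR
    simp only [intF_zero, mul_zero, Finset.sum_const_zero, sub_zero] at this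
    linarith
  simp only [mul_sub, Finset.sum_sub_distrib]
  rw [htr, Finset.mul_sum]
  have : ∑ j, Real.log R * (pr j * (T' j).trace) = ∑ j, pr j * (Real.log R * (T' j).trace) :=
    Finset.sum_congr rfl fun j _ => by ring
  linarith

lemma relEnt_eq {P V B Y : Matrix ι ι ℝ} {p β : ι → ℝ} (hP : IsRep P V p) (hB : IsRep B Y β) :
    relEnt V Y (fun i => Real.exp (p i)) (fun i => Real.exp (β i))
      = (NormedSpace.exp P * (P - B)).trace := by
  rw [Matrix.mul_sub, Matrix.trace_sub, trace_two hP.exp hB, (rep_self_mul hP.exp hP).trace,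
    trace_left hP hB (fun i => _ * _), ← Finset.sum_sub_distrib, relEnt]
  refine Finset.sum_congr rfl fun a _ => ?_
  rw [← Finset.sum_sub_distrib]
  refine Finset.sum_congr rfl fun b _ => ?_
  rw [Real.log_exp, Real.log_exp]
  ring

lemma IsRep.posDef {A V : Matrix ι ι ℝ} {p : ι → ℝ} (h : IsRep A V p) (hp : ∀ i, 0 < p i) :
    A.PosDef := by
  have h1 : (diagonal p).PosDef := Matrix.PosDef.diagonal hp
  have hu : IsUnit Vᵀ := ⟨⟨Vᵀ, V, h.h1, h.h2⟩, rfl⟩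
  have := (Matrix.IsUnit.posDef_star_left_conjugate_iff hu (x := diagonal p)).2 h1
  rw [h.eq]
  simpa [star_eq_conjTranspose] using this

/-- Lieb's concavity in Jensen form. -/
lemma lieb_jensen {J : Type*} [Fintype J] {pr : J → ℝ} (hpr : ∀ j, 0 ≤ pr j)
    (hsum : ∑ j, pr j = 1) {H B : Matrix ι ι ℝ} {B' : J → Matrix ι ι ℝ}
    (hH : H.IsHermitian) (hB : B.IsHermitian) (hB' : ∀ j, (B' j).IsHermitian)
    (hle : (NormedSpace.exp B - ∑ j, pr j • NormedSpace.exp (B' j)).PosSemidef) :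
    ∑ j, pr j * (NormedSpace.exp (H + B' j)).trace ≤ (NormedSpace.exp (H + B)).trace := by
  choose V' q' hP' using fun j => exists_rep (hH.add (hB' j))
  choose Y' β' hR' using fun j => exists_rep (hB' j)
  obtain ⟨Y, β, hR⟩ := exists_rep hB
  have hTpd : (∑ j, pr j • NormedSpace.exp (H + B' j)).PosDef := by
    obtain ⟨j0, hj0⟩ : ∃ j, 0 < pr j := by
      by_contra hcon
      push Not at hcon
      have : ∑ j, pr j ≤ 0 := Finset.sum_nonpos fun j _ => hcon j
      linarith
    classical
    rw [← Finset.add_sum_erase _ _ (Finset.mem_univ j0)]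
    refine Matrix.PosDef.add_posSemidef ?_ ?_
    · exact ((hP' j0).exp.posDef fun i => Real.exp_pos _).smul hj0
    · refine Matrix.posSemidef_sum _ fun j _ => ?_
      exact ((hP' j).exp.posDef fun i => Real.exp_pos _).posSemidef.smul (hpr j)
  obtain ⟨T, hTdef⟩ : ∃ T, T = ∑ j, pr j • NormedSpace.exp (H + B' j) := ⟨_, rfl⟩
  rw [← hTdef] at hTpd
  obtain ⟨V, τ, hT⟩ := exists_rep hTpd.isHermitian
  have hτ : ∀ i, 0 < τ i := by
    intro i
    have hu : IsUnit Vᵀ := ⟨⟨Vᵀ, V, hT.h1, hT.h2⟩, rfl⟩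
    rw [hT.eq] at hTpd
    have := (Matrix.IsUnit.posDef_star_left_conjugate_iff hu (x := diagonal τ)).1
      (by simpa [star_eq_conjTranspose] using hTpd)
    exact Matrix.posDef_diagonal_iff.1 this i
  obtain ⟨P, hPdef⟩ : ∃ P, P = V * diagonal (fun i => Real.log (τ i)) * Vᵀ := ⟨_, rfl⟩
  have hP : IsRep P V (fun i => Real.log (τ i)) := ⟨hT.h1, hT.h2, hPdef⟩
  have hPT : NormedSpace.exp P = T := by
    rw [hP.exp.eq, hT.eq]
    simp only [Real.exp_log (hτ _)]
  have key := relEnt_convex hpr hP.exp hR.exp (fun i => Real.exp_pos _) (fun i => Real.exp_pos _)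
    (fun j => (hP' j).exp) (fun j => (hR' j).exp) (fun j i => Real.exp_pos _)
    (fun j i => Real.exp_pos _) (hPT.trans hTdef) hle
  rw [relEnt_eq hP hR] at key
  simp only [relEnt_eq (hP' _) (hR' _), add_sub_cancel_right] at key
  have h2 : ∑ j, pr j * (NormedSpace.exp (H + B' j) * H).trace = (T * H).trace := by
    rw [hTdef, Matrix.sum_mul, Matrix.trace_sum]
    simp [Matrix.trace_smul]
  have h3 : ∑ j, pr j * (NormedSpace.exp (H + B' j)).trace = T.trace := by
    rw [hTdef, Matrix.trace_sum]
    simp [Matrix.trace_smul]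
  rw [h2, hPT] at key
  have kl := klein hP.isHermitian (hH.add hB)
  rw [hPT] at kl
  rw [h3]
  have : (T * (H + B - P)).trace = (T * H).trace - (T * (P - B)).trace := by
    rw [← Matrix.trace_sub, ← Matrix.mul_sub]; congr 2; abel
  linarith

end LiebPart

section ConcPart
variable {ι : Type*} [Fintype ι] [DecidableEq ι]

lemma IsRep.add {A B V : Matrix ι ι ℝ} {p q : ι → ℝ} (hA : IsRep A V p) (hB : IsRep B V q) :
    IsRep (A + B) V (fun i => p i + q i) := by
  refine ⟨hA.h1, hA.h2, ?_⟩
  rw [hA.eq, hB.eq, ← Matrix.diagonal_add, Matrix.mul_add, Matrix.add_mul]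

lemma IsRep.smul {A V : Matrix ι ι ℝ} {p : ι → ℝ} (hA : IsRep A V p) (r : ℝ) :
    IsRep (r • A) V (fun i => r * p i) := by
  refine ⟨hA.h1, hA.h2, ?_⟩
  have e : diagonal (fun i => r * p i) = r • diagonal p := by
    rw [← Matrix.diagonal_smul]; rfl
  rw [e, hA.eq, Matrix.mul_smul, Matrix.smul_mul]

lemma IsRep.sub {A B V : Matrix ι ι ℝ} {p q : ι → ℝ} (hA : IsRep A V p) (hB : IsRep B V q) :
    IsRep (A - B) V (fun i => p i - q i) := by
  have := hA.add (hB.smul (-1))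
  simpa [sub_eq_add_neg] using this

lemma IsRep.one {A V : Matrix ι ι ℝ} {p : ι → ℝ} (hA : IsRep A V p) :
    IsRep (1 : Matrix ι ι ℝ) V (fun _ => 1) := by
  refine ⟨hA.h1, hA.h2, ?_⟩
  simp [hA.h2]

lemma IsRep.psd_iff {A V : Matrix ι ι ℝ} {p : ι → ℝ} (h : IsRep A V p) :
    A.PosSemidef ↔ ∀ i, 0 ≤ p i := by
  have hu : IsUnit Vᵀ := ⟨⟨Vᵀ, V, h.h1, h.h2⟩, rfl⟩
  have := Matrix.IsUnit.posSemidef_star_left_conjugate_iff hu (x := diagonal p)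
  rw [Matrix.posSemidef_diagonal_iff] at this
  rw [← this, h.eq]
  simp [star_eq_conjTranspose]

lemma exp_chord {θ L p : ℝ} (hL : 0 < L) (h0 : 0 ≤ p) (h1 : p ≤ L) :
    Real.exp (θ * p) ≤ 1 + (Real.exp (θ * L) - 1) / L * p := by
  have := convexOn_exp.2 (Set.mem_univ (0 : ℝ)) (Set.mem_univ (θ * L))
    (show 0 ≤ 1 - p / L by rw [sub_nonneg, div_le_one hL]; exact h1)
    (show 0 ≤ p / L by positivity) (by ring)
  simp only [smul_eq_mul, mul_zero, zero_add, Real.exp_zero, mul_one] at this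
  have e : p / L * (θ * L) = θ * p := by field_simp
  rw [e] at this
  calc _ ≤ _ := this
    _ = _ := by field_simp; ring

lemma exp_le_of_bdd {Z : Matrix ι ι ℝ} {θ L : ℝ} (hL : 0 < L) (hZ : Z.PosSemidef)
    (hZL : (L • (1 : Matrix ι ι ℝ) - Z).PosSemidef) :
    ((1 : Matrix ι ι ℝ) + ((Real.exp (θ * L) - 1) / L) • Z
      - NormedSpace.exp (θ • Z)).PosSemidef := by
  obtain ⟨V, p, hp⟩ := exists_rep hZ.isHermitian
  rw [((hp.one.add (hp.smul _)).sub (hp.smul θ).exp).psd_iff]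
  intro i
  have h0 := hp.psd_iff.1 hZ i
  have h1 := ((hp.one.smul L).sub hp).psd_iff.1 hZL i
  have := exp_chord (θ := θ) hL h0 (by linarith)
  linarith

lemma mgf_bound {J : Type*} [Fintype J] {pr : J → ℝ} (hpr : ∀ j, 0 ≤ pr j)
    (hsum : ∑ j, pr j = 1) {Z : J → Matrix ι ι ℝ} {C : Matrix ι ι ℝ} {θ L : ℝ} (hL : 0 < L)
    (hC : C.IsHermitian) (hZ : ∀ j, (Z j).PosSemidef)
    (hZL : ∀ j, (L • (1 : Matrix ι ι ℝ) - Z j).PosSemidef) (hZC : ∑ j, pr j • Z j = C) :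
    (NormedSpace.exp (((Real.exp (θ * L) - 1) / L) • C)
      - ∑ j, pr j • NormedSpace.exp (θ • Z j)).PosSemidef := by
  set g := (Real.exp (θ * L) - 1) / L
  obtain ⟨V, p, hp⟩ := exists_rep hC
  have h1 : (NormedSpace.exp (g • C) - (1 + g • C)).PosSemidef := by
    rw [((hp.smul g).exp.sub (hp.one.add (hp.smul g))).psd_iff]
    intro i
    linarith [Real.add_one_le_exp (g * p i)]
  have h2 : (∑ j, pr j • ((1 : Matrix ι ι ℝ) + g • Z j - NormedSpace.exp (θ • Z j))).PosSemidef :=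
    Matrix.posSemidef_sum _ fun j _ => (exp_le_of_bdd hL (hZ j) (hZL j)).smul (hpr j)
  have e : ∑ j, pr j • ((1 : Matrix ι ι ℝ) + g • Z j - NormedSpace.exp (θ • Z j))
      = (1 + g • C) - ∑ j, pr j • NormedSpace.exp (θ • Z j) := by
    simp only [smul_sub, smul_add, Finset.sum_sub_distrib, Finset.sum_add_distrib]
    rw [← Finset.sum_smul, hsum, one_smul, ← hZC, Finset.smul_sum]
    simp only [smul_comm g]
  rw [e] at h2
  have := h1.add h2
  simpa using this

lemma sum_fin_succ {J : Type*} [Fintype J] {m : ℕ} (F : (Fin (m + 1) → J) → ℝ) :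
    ∑ ω, F ω = ∑ j, ∑ ω, F (Fin.cons j ω) := by
  rw [← Fintype.sum_prod_type' (f := fun j ω => F (Fin.cons j ω))]
  exact (Fintype.sum_equiv (Fin.consEquiv fun _ => J) _ _ fun x => rfl).symm

lemma mgf_iter {J : Type*} [Fintype J] {pr : J → ℝ} (hpr : ∀ j, 0 ≤ pr j)
    (hsum : ∑ j, pr j = 1) {B : Matrix ι ι ℝ} {B' : J → Matrix ι ι ℝ}
    (hB : B.IsHermitian) (hB' : ∀ j, (B' j).IsHermitian)
    (hle : (NormedSpace.exp B - ∑ j, pr j • NormedSpace.exp (B' j)).PosSemidef) (m : ℕ) :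
    ∀ H : Matrix ι ι ℝ, H.IsHermitian →
    ∑ ω : Fin m → J, (∏ i, pr (ω i)) * (NormedSpace.exp (H + ∑ i, B' (ω i))).trace
      ≤ (NormedSpace.exp (H + (m : ℝ) • B)).trace := by
  induction m with
  | zero => intro H hH; simp
  | succ m ih =>
    intro H hH
    have hmB : ((m : ℝ) • B).IsHermitian := hB.smul (IsSelfAdjoint.all _)
    rw [sum_fin_succ]
    calc _ = ∑ j, pr j * ∑ ω : Fin m → J, (∏ i, pr (ω i)) *
          (NormedSpace.exp ((H + B' j) + ∑ i, B' (ω i))).trace := by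
          refine Finset.sum_congr rfl fun j _ => ?_
          rw [Finset.mul_sum]
          refine Finset.sum_congr rfl fun ω _ => ?_
          rw [Fin.prod_univ_succ, Fin.sum_univ_succ]
          simp only [Fin.cons_zero, Fin.cons_succ]
          rw [mul_assoc, add_assoc]
      _ ≤ ∑ j, pr j * (NormedSpace.exp ((H + (m : ℝ) • B) + B' j)).trace := by
          refine Finset.sum_le_sum fun j _ => mul_le_mul_of_nonneg_left ?_ (hpr j)
          refine (ih _ (hH.add (hB' j))).trans_eq ?_
          rw [add_right_comm]
      _ ≤ (NormedSpace.exp ((H + (m : ℝ) • B) + B)).trace :=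
          lieb_jensen hpr hsum (hH.add hmB) hB hB' hle
      _ = _ := by
          congr 2
          push_cast
          rw [add_smul, one_smul, add_assoc]

lemma prob_sum {J : Type*} [Fintype J] {pr : J → ℝ} (hsum : ∑ j, pr j = 1) (m : ℕ) :
    ∑ ω : Fin m → J, ∏ i, pr (ω i) = 1 := by
  classical
  have := (Fintype.prod_sum (fun (_ : Fin m) j => pr j)).symm
  rw [this]
  simp [hsum]

lemma mean_sum {J : Type*} [Fintype J] {pr : J → ℝ} (hsum : ∑ j, pr j = 1) (f : J → ℝ) (m : ℕ) :
    ∑ ω : Fin m → J, (∏ i, pr (ω i)) * ∑ i, f (ω i) = m * ∑ j, pr j * f j := by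
  induction m with
  | zero => simp
  | succ m ih =>
    rw [sum_fin_succ]
    calc _ = ∑ j, (pr j * f j * (∑ ω : Fin m → J, ∏ i, pr (ω i)) +
          pr j * ∑ ω : Fin m → J, (∏ i, pr (ω i)) * ∑ i, f (ω i)) := by
          refine Finset.sum_congr rfl fun j _ => ?_
          rw [Finset.mul_sum, Finset.mul_sum, ← Finset.sum_add_distrib]
          refine Finset.sum_congr rfl fun ω _ => ?_
          rw [Fin.prod_univ_succ, Fin.sum_univ_succ]
          simp only [Fin.cons_zero, Fin.cons_succ]
          ring
      _ = _ := by
          rw [ih, prob_sum hsum, Finset.sum_add_distrib, ← Finset.sum_mul, ← Finset.sum_mul, hsum]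
          push_cast
          ring

lemma psi_nonneg (x : ℝ) : 0 ≤ Real.exp x - 1 - x := by linarith [Real.add_one_le_exp x]

lemma psi_mono {x y : ℝ} (hx : 0 ≤ x) (hxy : x ≤ y) :
    Real.exp x - 1 - x ≤ Real.exp y - 1 - y := by
  have h1 := Real.add_one_le_exp (y - x)
  have h2 : Real.exp y = Real.exp x * Real.exp (y - x) := by rw [← Real.exp_add]; ring_nf
  have h3 : 1 ≤ Real.exp x := Real.one_le_exp hx
  rw [h2]
  nlinarith

lemma psi_trace {S : Matrix ι ι ℝ} (hS : S.IsHermitian) :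
    0 ≤ (NormedSpace.exp S).trace - (1 : Matrix ι ι ℝ).trace - S.trace := by
  obtain ⟨V, s, h⟩ := exists_rep hS
  rw [h.trace, h.exp.trace, h.one.trace, ← Finset.sum_sub_distrib, ← Finset.sum_sub_distrib]
  exact Finset.sum_nonneg fun i _ => psi_nonneg _

lemma psi_tail {S : Matrix ι ι ℝ} (hS : S.IsHermitian) {x : ℝ} (hx : 0 ≤ x)
    (hn : ¬ (x • (1 : Matrix ι ι ℝ) - S).PosSemidef) :
    Real.exp x - 1 - x ≤ (NormedSpace.exp S).trace - (1 : Matrix ι ι ℝ).trace - S.trace := by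
  obtain ⟨V, s, h⟩ := exists_rep hS
  rw [((h.one.smul x).sub h).psd_iff] at hn
  push Not at hn
  obtain ⟨i, hi⟩ := hn
  rw [h.trace, h.exp.trace, h.one.trace, ← Finset.sum_sub_distrib, ← Finset.sum_sub_distrib]
  refine (psi_mono hx (show x ≤ s i by linarith)).trans ?_
  exact Finset.single_le_sum (f := fun i => Real.exp (s i) - 1 - s i)
    (fun i _ => psi_nonneg _) (Finset.mem_univ i)

open Classical in
lemma conc_one {J : Type*} [Fintype J] {pr : J → ℝ} (hpr : ∀ j, 0 ≤ pr j)
    (hsum : ∑ j, pr j = 1) {Z : J → Matrix ι ι ℝ} {c : ι → ℝ} {θ L : ℝ} (hL : 0 < L)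
    (hZ : ∀ j, (Z j).PosSemidef)
    (hZL : ∀ j, (L • (1 : Matrix ι ι ℝ) - Z j).PosSemidef) (hZC : ∑ j, pr j • Z j = diagonal c)
    {cm : ℝ} (hcm : 0 < cm) (hc0 : ∀ i, 0 ≤ c i) (hc : ∀ i, c i ≤ cm) {x : ℝ} (hx : 0 ≤ x)
    (m : ℕ) :
    (∑ ω : Fin m → J, if (x • (1 : Matrix ι ι ℝ) -
        θ • (∑ i, Z (ω i) - (m : ℝ) • diagonal c)).PosSemidef then 0 else ∏ i, pr (ω i))
      * (Real.exp x - 1 - x) ≤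
      (∑ i, c i) / cm * (Real.exp (m * ((Real.exp (θ * L) - 1 - θ * L) / L) * cm) - 1) := by
  set C := diagonal c with hCdef
  have hCrep : IsRep C 1 c := ⟨by simp, by simp, by simp [hCdef]⟩
  have hC : C.IsHermitian := hCrep.isHermitian
  have hθZ : ∀ j, (θ • Z j).IsHermitian := fun j => (hZ j).isHermitian.smul (IsSelfAdjoint.all _)
  set g := (Real.exp (θ * L) - 1) / L with hg
  have hgC : (g • C).IsHermitian := hC.smul (IsSelfAdjoint.all _)
  have hH : (-(m * θ) • C).IsHermitian := hC.smul (IsSelfAdjoint.all _)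
  have hS : ∀ ω : Fin m → J, θ • (∑ i, Z (ω i) - (m : ℝ) • C)
      = -(m * θ) • C + ∑ i, θ • Z (ω i) := by
    intro ω
    rw [smul_sub, smul_smul, ← Finset.smul_sum, neg_smul, mul_comm θ]
    abel
  have hSh : ∀ ω : Fin m → J, (-(m * θ) • C + ∑ i, θ • Z (ω i)).IsHermitian := fun ω =>
    hH.add (by
      rw [Matrix.IsHermitian, Matrix.conjTranspose_sum]
      exact Finset.sum_congr rfl fun i _ => (hθZ (ω i)))
  have key := mgf_iter hpr hsum hgC hθZ (mgf_bound hpr hsum hL hC hZ hZL hZC) m _ hH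
  have hmean : ∑ ω : Fin m → J, (∏ i, pr (ω i)) * (-(m * θ) • C + ∑ i, θ • Z (ω i)).trace = 0 := by
    simp only [Matrix.trace_add, Matrix.trace_sum, mul_add, Finset.sum_add_distrib]
    rw [mean_sum hsum (fun j => (θ • Z j).trace), ← Finset.sum_mul, prob_sum hsum]
    have : C.trace = ∑ j, pr j * (Z j).trace := by
      rw [← hZC, Matrix.trace_sum]; simp [Matrix.trace_smul]
    simp only [Matrix.trace_smul, smul_eq_mul]
    rw [this]
    simp only [Finset.mul_sum, ← Finset.sum_add_distrib]
    refine Finset.sum_eq_zero fun j _ => by ring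
  have hpω : ∀ ω : Fin m → J, 0 ≤ ∏ i, pr (ω i) := fun ω => Finset.prod_nonneg fun i _ => hpr _
  calc _ ≤ ∑ ω : Fin m → J, (∏ i, pr (ω i)) *
        ((NormedSpace.exp (-(m * θ) • C + ∑ i, θ • Z (ω i))).trace - (1 : Matrix ι ι ℝ).trace
          - (-(m * θ) • C + ∑ i, θ • Z (ω i)).trace) := by
        rw [Finset.sum_mul]
        refine Finset.sum_le_sum fun ω _ => ?_
        rw [hS ω]
        split_ifs with h
        · rw [zero_mul]
          exact mul_nonneg (hpω ω) (psi_trace (hSh ω))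
        · exact mul_le_mul_of_nonneg_left (psi_tail (hSh ω) hx h) (hpω ω)
    _ = ∑ ω : Fin m → J, (∏ i, pr (ω i)) *
        (NormedSpace.exp (-(m * θ) • C + ∑ i, θ • Z (ω i))).trace - (1 : Matrix ι ι ℝ).trace := by
        simp only [mul_sub, Finset.sum_sub_distrib]
        rw [hmean, ← Finset.sum_mul, prob_sum hsum]
        ring
    _ ≤ (NormedSpace.exp (-(m * θ) • C + (m : ℝ) • g • C)).trace - (1 : Matrix ι ι ℝ).trace := by
        linarith
    _ = ∑ i, (Real.exp (m * ((Real.exp (θ * L) - 1 - θ * L) / L) * c i) - 1) := by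
        have e : -(m * θ) • C + (m : ℝ) • g • C
            = (m * ((Real.exp (θ * L) - 1 - θ * L) / L)) • C := by
          rw [smul_smul, ← add_smul]
          congr 1
          rw [hg]; field_simp; ring
        rw [e, (hCrep.smul _).exp.trace, hCrep.one.trace, ← Finset.sum_sub_distrib]
    _ ≤ _ := by
        rw [Finset.sum_div, Finset.sum_mul]
        refine Finset.sum_le_sum fun i _ => ?_
        have := exp_chord (θ := m * ((Real.exp (θ * L) - 1 - θ * L) / L)) hcm (hc0 i) (hc i)
        calc _ ≤ _ := sub_le_sub_right this 1
          _ = _ := by ring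
end ConcPart

section GaussPart

noncomputable def radialMass : ENNReal :=
  ∫⁻ r in Set.Ioi (0 : ℝ), ENNReal.ofReal r *
    ENNReal.ofReal ((Real.sqrt (2 * Real.pi))⁻¹ ^ 2 * Real.exp (-r ^ 2 / 2))

lemma polar_meas (S : Set (ℝ × ℝ)) (hS : MeasurableSet S) (B : Set ℝ) (hB : MeasurableSet B)
    (h : ∀ r φ : ℝ, 0 < r → φ ∈ Set.Ioo (-Real.pi) Real.pi →
      ((r * Real.cos φ, r * Real.sin φ) ∈ S ↔ φ ∈ B)) :
    ((gaussianReal 0 1).prod (gaussianReal 0 1)) S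
      = radialMass * volume (B ∩ Set.Ioo (-Real.pi) Real.pi) := by
  rw [gaussianReal_of_var_ne_zero 0 one_ne_zero,
    prod_withDensity (measurable_gaussianPDF 0 1) (measurable_gaussianPDF 0 1),
    withDensity_apply _ hS, ← lintegral_indicator hS, ← Measure.volume_eq_prod,
    ← lintegral_comp_polarCoord_symm]
  have htgt : polarCoord.target = Set.Ioi (0 : ℝ) ×ˢ Set.Ioo (-Real.pi) Real.pi := rfl
  have hmeas : MeasurableSet polarCoord.target := by
    rw [htgt]; exact measurableSet_Ioi.prod measurableSet_Ioo
  have e : ∫⁻ (p : ℝ × ℝ) in polarCoord.target, ENNReal.ofReal p.1 •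
      S.indicator (fun z => gaussianPDF 0 1 z.1 * gaussianPDF 0 1 z.2) (polarCoord.symm p)
      = ∫⁻ (p : ℝ × ℝ) in polarCoord.target, (ENNReal.ofReal p.1 *
        ENNReal.ofReal ((Real.sqrt (2 * Real.pi))⁻¹ ^ 2 * Real.exp (-p.1 ^ 2 / 2))) *
          B.indicator 1 p.2 := by
    refine setLIntegral_congr_fun hmeas ?_
    rintro ⟨r, φ⟩ ⟨hr, hφ⟩
    have hr' : 0 < r := hr
    simp only [polarCoord_symm_apply, smul_eq_mul]
    rw [mul_assoc]
    congr 1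
    by_cases hb : φ ∈ B
    · rw [Set.indicator_of_mem hb, Set.indicator_of_mem ((h r φ hr' hφ).2 hb)]
      simp only [Pi.one_apply, mul_one, gaussianPDF]
      rw [← ENNReal.ofReal_mul (gaussianPDFReal_nonneg _ _ _)]
      congr 1
      simp only [gaussianPDFReal_def, NNReal.coe_one, mul_one, sub_zero]
      have : Real.exp (-r ^ 2 / 2) = Real.exp (-(r * Real.cos φ) ^ 2 / 2) *
          Real.exp (-(r * Real.sin φ) ^ 2 / 2) := by
        rw [← Real.exp_add]
        congr 1
        have := Real.sin_sq_add_cos_sq φ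
        linear_combination (-(r ^ 2) / 2) * (-this)
      rw [this]
      ring
    · rw [Set.indicator_of_notMem hb, Set.indicator_of_notMem (fun hh => hb ((h r φ hr' hφ).1 hh))]
      simp
  rw [e, htgt, Measure.volume_eq_prod, ← Measure.prod_restrict, lintegral_prod_mul
    (f := fun r => ENNReal.ofReal r *
        ENNReal.ofReal ((Real.sqrt (2 * Real.pi))⁻¹ ^ 2 * Real.exp (-r ^ 2 / 2)))]
  · rw [lintegral_indicator_one hB, Measure.restrict_apply hB, radialMass]
  · fun_prop
  · exact (measurable_one.indicator hB).aemeasurable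

lemma radialMass_eq : radialMass * ENNReal.ofReal (2 * Real.pi) = 1 := by
  have := polar_meas Set.univ MeasurableSet.univ Set.univ MeasurableSet.univ (by simp)
  rw [measure_univ, Set.univ_inter, Real.volume_Ioo] at this
  rw [this]
  congr 2
  ring

lemma orthant2 {ϑ : ℝ} (h0 : 0 ≤ ϑ) (hπ : ϑ ≤ Real.pi) :
    ((gaussianReal 0 1).prod (gaussianReal 0 1))
      {z | 0 < z.1 ∧ 0 < Real.cos ϑ * z.1 + Real.sin ϑ * z.2}
      = ENNReal.ofReal ((Real.pi - ϑ) / (2 * Real.pi)) := by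
  have hpi := Real.pi_pos
  rw [polar_meas _ ?_ (Set.Ioo (ϑ - Real.pi / 2) (Real.pi / 2)) measurableSet_Ioo]
  · rw [Set.inter_eq_left.2, Real.volume_Ioo]
    · have e : Real.pi / 2 - (ϑ - Real.pi / 2) = (2 * Real.pi) * ((Real.pi - ϑ) / (2 * Real.pi)) := by
        field_simp; ring
      rw [e, ENNReal.ofReal_mul (by positivity), ← mul_assoc, radialMass_eq, one_mul]
    · rintro φ ⟨h1, h2⟩
      exact ⟨by linarith, by linarith⟩
  · intro r φ hr hφ
    have e : Real.cos ϑ * (r * Real.cos φ) + Real.sin ϑ * (r * Real.sin φ)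
        = r * Real.cos (φ - ϑ) := by rw [Real.cos_sub]; ring
    simp only [Set.mem_setOf_eq, e, mul_pos_iff_of_pos_left hr, Set.mem_Ioo]
    constructor
    · rintro ⟨h1, h2⟩
      have hφ2 : φ < Real.pi / 2 := by
        by_contra hc
        push Not at hc
        have := Real.cos_nonpos_of_pi_div_two_le_of_le hc (by linarith [hφ.2])
        linarith
      refine ⟨?_, hφ2⟩
      have hφ1 : - (Real.pi / 2) < φ := by
        by_contra hc
        push Not at hc
        have := Real.cos_nonpos_of_pi_div_two_le_of_le (x := -φ) (by linarith)
          (by linarith [hφ.1])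
        rw [Real.cos_neg] at this
        linarith
      by_contra hc
      push Not at hc
      have := Real.cos_nonpos_of_pi_div_two_le_of_le (x := -(φ - ϑ)) (by linarith)
          (by linarith [hφ.1])
      rw [Real.cos_neg] at this
      linarith
    · rintro ⟨h1, h2⟩
      exact ⟨Real.cos_pos_of_mem_Ioo ⟨by linarith, by linarith⟩,
        Real.cos_pos_of_mem_Ioo ⟨by linarith, by linarith⟩⟩
  · apply MeasurableSet.inter
    · exact measurableSet_lt measurable_const measurable_fst
    · have hf : Measurable fun z : ℝ × ℝ => Real.cos ϑ * z.1 + Real.sin ϑ * z.2 := by fun_prop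
      exact measurableSet_lt measurable_const hf

lemma charFunDual_std (L : StrongDual ℝ ℝ) :
    charFunDual (gaussianReal 0 1) L = Complex.exp (-((L 1 : ℝ) : ℂ) ^ 2 / 2) := by
  have h := charFun_gaussianReal (μ := 0) (v := 1) (L 1)
  rw [charFun_apply_real] at h
  rw [charFunDual_apply]
  have : ∀ v : ℝ, L v = L 1 * v := by
    intro v
    have := L.map_smul v 1
    simp only [smul_eq_mul, mul_one] at this
    rw [this, mul_comm]
  have e : (fun v : ℝ => Complex.exp ((L v : ℝ) * Complex.I))
      = fun v : ℝ => Complex.exp ((L 1 : ℝ) * v * Complex.I) := by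
    funext v
    rw [this v, Complex.ofReal_mul]
  rw [e, h]
  congr 1
  simp
  ring

noncomputable def pairL {d : ℕ} (x y : Fin d → ℝ) : (Fin d → ℝ) →L[ℝ] ℝ × ℝ :=
  (∑ k, x k • ContinuousLinearMap.proj k).prod (∑ k, y k • ContinuousLinearMap.proj k)

lemma pairL_apply {d : ℕ} (x y w : Fin d → ℝ) :
    pairL x y w = (∑ k, x k * w k, ∑ k, y k * w k) := by
  simp [pairL]

noncomputable def rotL (ϑ : ℝ) : (ℝ × ℝ) →L[ℝ] ℝ × ℝ :=
  (ContinuousLinearMap.fst ℝ ℝ ℝ).prod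
    (Real.cos ϑ • ContinuousLinearMap.fst ℝ ℝ ℝ + Real.sin ϑ • ContinuousLinearMap.snd ℝ ℝ ℝ)

lemma rotL_apply (ϑ : ℝ) (z : ℝ × ℝ) :
    rotL ϑ z = (z.1, Real.cos ϑ * z.1 + Real.sin ϑ * z.2) := by
  simp [rotL]

lemma dual_pair (L : StrongDual ℝ (ℝ × ℝ)) (a b : ℝ) :
    L (a, b) = L (1, 0) * a + L (0, 1) * b := by
  have : ((a, b) : ℝ × ℝ) = a • (1, 0) + b • (0, 1) := by simp
  rw [this, map_add, map_smul, map_smul]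
  simp only [smul_eq_mul]
  ring

lemma pair_law {d : ℕ} (x y : Fin d → ℝ) (hx : ∑ k, x k ^ 2 = 1) (hy : ∑ k, y k ^ 2 = 1) (ϑ : ℝ)
    (hxy : ∑ k, x k * y k = Real.cos ϑ) :
    (Measure.pi fun _ : Fin d => gaussianReal 0 1).map (pairL x y)
      = ((gaussianReal 0 1).prod (gaussianReal 0 1)).map (rotL ϑ) := by
  have : IsFiniteMeasure ((Measure.pi fun _ : Fin d => gaussianReal 0 1).map (pairL x y)) :=
    Measure.isFiniteMeasure_map _ _
  have : IsFiniteMeasure (((gaussianReal 0 1).prod (gaussianReal 0 1)).map (rotL ϑ)) :=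
    Measure.isFiniteMeasure_map _ _
  apply Measure.ext_of_charFunDual
  ext L
  rw [charFunDual_map, charFunDual_map, charFunDual_pi, charFunDual_prod]
  simp only [charFunDual_std, ContinuousLinearMap.comp_apply, ContinuousLinearMap.single_apply,
    ContinuousLinearMap.inl_apply, ContinuousLinearMap.inr_apply, pairL_apply, rotL_apply,
    dual_pair L (∑ k, _) _, dual_pair L _ (_ + _)]
  generalize L (1, 0) = a
  generalize L (0, 1) = b
  rw [← Complex.exp_sum, ← Complex.exp_add]
  congr 1
  have e : ∀ (f : Fin d → ℝ) (k : Fin d), ∑ j, f j * (Pi.single k (1 : ℝ) : Fin d → ℝ) j = f k := by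
    intro f k; simp [Pi.single_apply]
  simp only [e]
  norm_cast
  have hs : ∑ k, (a * x k + b * y k) ^ 2 = a ^ 2 + 2 * a * b * Real.cos ϑ + b ^ 2 := by
    rw [← hxy]
    have : ∀ k, (a * x k + b * y k) ^ 2 = a ^ 2 * x k ^ 2 + 2 * a * b * (x k * y k)
      + b ^ 2 * y k ^ 2 := fun k => by ring
    simp only [this, Finset.sum_add_distrib, ← Finset.mul_sum, hx, hy]
    ring
  have h2 : ∑ k, -(a * x k + b * y k) ^ 2 / 2 = -(∑ k, (a * x k + b * y k) ^ 2) / 2 := by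
    rw [← Finset.sum_div, Finset.sum_neg_distrib]
  rw [h2, hs]
  have := Real.sin_sq_add_cos_sq ϑ
  simp only [mul_one, mul_zero, add_zero, zero_add]
  linear_combination (-(b ^ 2) / 2) * (-this)

lemma orthant_unit {d : ℕ} (x y : Fin d → ℝ) (hx : ∑ k, x k ^ 2 = 1) (hy : ∑ k, y k ^ 2 = 1) :
    (Measure.pi fun _ : Fin d => gaussianReal 0 1)
      {w | 0 < ∑ k, x k * w k ∧ 0 < ∑ k, y k * w k}
      = ENNReal.ofReal ((Real.pi - Real.arccos (∑ k, x k * y k)) / (2 * Real.pi)) := by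
  have hcs : (∑ k, x k * y k) ^ 2 ≤ 1 := by
    have := Finset.sum_mul_sq_le_sq_mul_sq Finset.univ x y
    rw [hx, hy] at this
    linarith
  have hab := abs_le.1 ((sq_le_one_iff_abs_le_one _).1 hcs)
  have hcos : ∑ k, x k * y k = Real.cos (Real.arccos (∑ k, x k * y k)) :=
    (Real.cos_arccos hab.1 hab.2).symm
  have hlaw := pair_law x y hx hy _ hcos
  have hQ : MeasurableSet {z : ℝ × ℝ | 0 < z.1 ∧ 0 < z.2} :=
    (measurableSet_lt measurable_const measurable_fst).inter
      (measurableSet_lt measurable_const measurable_snd)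
  have h2 := congrArg (fun μ => μ {z : ℝ × ℝ | 0 < z.1 ∧ 0 < z.2}) hlaw
  beta_reduce at h2
  rw [Measure.map_apply (pairL x y).continuous.measurable hQ,
    Measure.map_apply (rotL _).continuous.measurable hQ] at h2
  simp only [Set.preimage_setOf_eq, pairL_apply, rotL_apply] at h2
  rw [h2, orthant2 (Real.arccos_nonneg _) (Real.arccos_le_pi _)]

end GaussPart

section NumPart
lemma psi_le {t u : ℝ} (hu0 : 0 ≤ u) (hu1 : u ≤ 1) (ht : t = u ∨ t = -u) :
    (Real.exp t - 1 - t) * (1 - u / 3) ≤ u ^ 2 / 2 := by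
  have h3 : (0:ℝ) < 1 - u / 3 := by linarith
  have hb := Real.exp_bound (x := t) (by rcases ht with h | h <;> rw [h] <;> simp [abs_of_nonneg hu0, hu1]) (n := 4) (by norm_num)
  have hb2 := (abs_le.1 hb).2
  simp [Finset.sum_range_succ, Nat.factorial] at hb2
  have habs : |t| = u := by rcases ht with h | h <;> rw [h] <;> simp [abs_of_nonneg hu0]
  rw [habs] at hb2
  have ht2 : t ^ 2 = u ^ 2 := by rcases ht with h | h <;> rw [h]; ring
  have ht3 : t ^ 3 ≤ u ^ 3 := by
    rcases ht with h | h <;> rw [h]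
    have : 0 ≤ u ^ 3 := by positivity
    nlinarith
  have key : Real.exp t - 1 - t ≤ u ^ 2 / 2 * (1 + u / 3 + u ^ 2 / 9) := by
    have : 0 ≤ u ^ 4 := by positivity
    nlinarith
  calc _ ≤ u ^ 2 / 2 * (1 + u / 3 + u ^ 2 / 9) * (1 - u / 3) := by gcongr
    _ = u ^ 2 / 2 * (1 - u ^ 3 / 27) := by ring
    _ ≤ u ^ 2 / 2 * 1 := by
      gcongr
      have : 0 ≤ u ^ 3 := by positivity
      linarith
    _ = _ := by ring

set_option maxHeartbeats 2000000 in
lemma numer {N ε cm L u s δ M x θ P : ℝ} (hN : 1 ≤ N) (he0 : 0 < ε) (he1 : ε < 1 / 2)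
    (hcm : cm = N / (N + 1)) (hL : L = N / 2 + 1) (hu : u = ε / (cm + ε / 3))
    (hs : 1 / 2 ≤ s) (hd0 : 0 < δ) (hd1 : δ < 1)
    (hM : (8 / 3) * (N / ε ^ 2) * Real.log (16 * s / δ) ≤ M) (hx : x = u * M * ε / L)
    (hθ : θ * L = u ∨ θ * L = -u)
    (hP : P * (Real.exp x - 1 - x) ≤
      s / cm * (Real.exp (M * ((Real.exp (θ * L) - 1 - θ * L) / L) * cm) - 1)) :
    P ≤ δ / 4 := by
  have hcm2 : 1 / 2 ≤ cm := by rw [hcm, div_le_div_iff₀ (by norm_num) (by linarith)]; linarith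
  have hL0 : 0 < L := by rw [hL]; linarith
  have hq : 0 < cm + ε / 3 := by linarith
  have hu0 : 0 < u := by rw [hu]; positivity
  have hu1 : u ≤ 1 := by rw [hu, div_le_one hq]; linarith
  have huq : u * (cm + ε / 3) = ε := by rw [hu]; field_simp
  set l := Real.log (16 * s / δ) with hl
  have hl2 : 2 ≤ l := by
    have h8 : Real.log 8 ≤ l := by
      apply Real.log_le_log (by norm_num)
      rw [le_div_iff₀ hd0]; nlinarith
    have : Real.log 8 = 3 * Real.log 2 := by
      rw [show (8:ℝ) = 2 ^ 3 by norm_num, Real.log_pow]; norm_num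
    linarith [Real.log_two_gt_d9]
  have hM0 : 0 < M := lt_of_lt_of_le (by positivity) hM
  have hgeo : 2 * L * (cm + ε / 3) ≤ 8 / 3 * N := by
    rw [hL, hcm]
    have : N / (N + 1) ≤ 1 := by rw [div_le_one (by linarith)]; linarith
    have h2 : (N + 2) * (N / (N + 1)) = N + N / (N + 1) := by field_simp; ring
    have h3 : (N + 2) * ε ≤ (N + 2) * (1 / 2) := by gcongr
    have h4 : 2 * (N / 2 + 1) * (N / (N + 1) + ε / 3) = (N + 2) * (N / (N + 1)) + (N + 2) * ε / 3 := by
      ring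
    rw [h4, h2]
    linarith
  have hE : l ≤ x / 2 := by
    have : x / 2 = M * ε ^ 2 / (2 * L * (cm + ε / 3)) := by
      rw [hx, hu]; field_simp
    rw [this, le_div_iff₀ (by positivity)]
    have h1 : l * (8 / 3 * N) ≤ M * ε ^ 2 := by
      have := mul_le_mul_of_nonneg_right hM (sq_nonneg ε)
      calc _ = 8 / 3 * (N / ε ^ 2) * l * ε ^ 2 := by field_simp
        _ ≤ _ := this
    exact (mul_le_mul_of_nonneg_left hgeo (by linarith)).trans h1
  have hpsi : (Real.exp (θ * L) - 1 - θ * L) * cm ≤ u * ε / 2 := by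
    have := psi_le hu0.le hu1 hθ
    have e : cm = (1 - u / 3) * (cm + ε / 3) := by
      linear_combination huq / 3
    rw [e, ← mul_assoc]
    calc _ ≤ u ^ 2 / 2 * (cm + ε / 3) := by gcongr
      _ = u * (u * (cm + ε / 3)) / 2 := by ring
      _ = _ := by rw [huq]
  have hexp : M * ((Real.exp (θ * L) - 1 - θ * L) / L) * cm ≤ x / 2 := by
    calc _ = M / L * ((Real.exp (θ * L) - 1 - θ * L) * cm) := by ring
      _ ≤ M / L * (u * ε / 2) := by gcongr
      _ = _ := by rw [hx]; ring
  have hx4 : 4 ≤ x := by linarith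
  have hq2 := Real.quadratic_le_exp_of_nonneg (show 0 ≤ x by linarith)
  have hhalf : Real.exp x / 2 ≤ Real.exp x - 1 - x := by nlinarith
  by_contra hcon
  push Not at hcon
  have hP0 : 0 < P := by linarith
  have hex : Real.exp x = Real.exp (x / 2) * Real.exp (x / 2) := by rw [← Real.exp_add]; ring_nf
  have h1 : P * (Real.exp (x / 2) * Real.exp (x / 2) / 2) ≤ 2 * s * Real.exp (x / 2) := by
    rw [← hex]
    calc _ ≤ _ := mul_le_mul_of_nonneg_left hhalf hP0.le
      _ ≤ _ := hP
      _ ≤ s / cm * Real.exp (x / 2) := by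
        gcongr
        linarith [Real.exp_le_exp.2 hexp]
      _ ≤ _ := by
        gcongr
        rw [div_le_iff₀ (by linarith)]; nlinarith
  have h2 : P * Real.exp (x / 2) ≤ 4 * s := by
    have hp := Real.exp_pos (x / 2)
    by_contra hh
    push Not at hh
    nlinarith
  have h3 : 16 * s / δ ≤ Real.exp (x / 2) := by
    rw [← Real.exp_log (show 0 < 16 * s / δ by positivity)]
    exact Real.exp_le_exp.2 hE
  have h4 : P * (16 * s / δ) ≤ 4 * s := (mul_le_mul_of_nonneg_left h3 hP0.le).trans h2
  rw [mul_div_assoc', div_le_iff₀ hd0] at h4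
  nlinarith
end NumPart

section CorePart
variable {n : ℕ} {J : Type*} [Fintype J]

lemma quad_sum (pr : J → ℝ) (f : J → Fin n → ℝ) (v : Fin n → ℝ) :
    v ⬝ᵥ ((∑ j, pr j • (2 : ℝ) • vecMulVec (f j) (f j)) *ᵥ v) = ∑ j, pr j * (2 * (f j ⬝ᵥ v) ^ 2) := by
  simp only [Matrix.sum_mulVec, Matrix.smul_mulVec, Matrix.vecMulVec_mulVec, dotProduct_sum,
    dotProduct_smul, smul_eq_mul]
  refine Finset.sum_congr rfl fun j _ => ?_
  rw [op_smul_eq_smul, dotProduct_comm v (f j), smul_eq_mul]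
  ring

lemma quad_lower {pr : J → ℝ} (hpr : ∀ j, 0 ≤ pr j) (hsum : ∑ j, pr j = 1) {f : J → Fin n → ℝ}
    (hf : ∀ j i, f j i = 0 ∨ f j i = 1) {K : Matrix (Fin n) (Fin n) ℝ}
    (hK : K = ∑ j, pr j • (2 : ℝ) • vecMulVec (f j) (f j)) (hK1 : ∀ i, K i i = 1) (v : Fin n → ℝ) :
    (∑ i, v i) ^ 2 / 2 ≤ v ⬝ᵥ (K *ᵥ v) := by
  have hE : ∀ i k, K i k = ∑ j, pr j * (2 * (f j i * f j k)) := by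
    intro i k
    rw [hK]
    simp [Matrix.sum_apply, vecMulVec_apply]
  have hE1 : ∀ i, ∑ j, pr j * (2 * f j i) = 1 := by
    intro i
    rw [← hK1 i, hE]
    refine Finset.sum_congr rfl fun j _ => ?_
    rcases hf j i with h | h <;> simp [h]
  have hK' : K = ∑ j, pr j • (2 : ℝ) • vecMulVec (fun i => 1 - f j i) (fun i => 1 - f j i) := by
    ext i k
    have : (∑ j, pr j • (2 : ℝ) • vecMulVec (fun i => 1 - f j i) (fun i => 1 - f j i)) i k
        = 2 * ∑ j, pr j - ∑ j, pr j * (2 * f j i) - ∑ j, pr j * (2 * f j k) + K i k := by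
      rw [hE, Finset.mul_sum, ← Finset.sum_sub_distrib, ← Finset.sum_sub_distrib,
        ← Finset.sum_add_distrib]
      simp only [Matrix.sum_apply, Matrix.smul_apply, vecMulVec_apply, smul_eq_mul]
      refine Finset.sum_congr rfl fun j _ => ?_
      ring
    rw [this, hE1, hE1, hsum]; ring
  have q1 := quad_sum pr f v
  have q2 := quad_sum pr (fun j i => 1 - f j i) v
  rw [← hK] at q1
  rw [← hK'] at q2
  have : (∑ i, v i) ^ 2 = ∑ j, pr j * (∑ i, v i) ^ 2 := by rw [← Finset.sum_mul, hsum, one_mul]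
  have h : (∑ i, v i) ^ 2 ≤ v ⬝ᵥ (K *ᵥ v) + v ⬝ᵥ (K *ᵥ v) := by
    conv_rhs => rw [q1]
    rw [← q1]
    nth_rewrite 1 [q1]
    rw [q2, this, ← Finset.sum_add_distrib]
    refine Finset.sum_le_sum fun j _ => ?_
    have e : ∑ i, v i = f j ⬝ᵥ v + (fun i => 1 - f j i) ⬝ᵥ v := by
      simp only [dotProduct, ← Finset.sum_add_distrib]
      refine Finset.sum_congr rfl fun j _ => ?_
      ring
    rw [e, ← mul_add]
    refine mul_le_mul_of_nonneg_left ?_ (hpr j)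
    nlinarith [sq_nonneg (f j ⬝ᵥ v - (fun i => 1 - f j i) ⬝ᵥ v)]
  linarith

lemma norm_bound {K : Matrix (Fin n) (Fin n) ℝ} (hq : ∀ v, (∑ i, v i) ^ 2 / 2 ≤ v ⬝ᵥ (K *ᵥ v))
    {lam : ℝ} (hlam : 0 < lam) {f v : Fin n → ℝ} (hf : ∀ i, f i = 0 ∨ f i = 1)
    (hv : (K + lam • (1 : Matrix (Fin n) (Fin n) ℝ)) *ᵥ v = f) :
    f ⬝ᵥ v ≤ 1 / 2 + n / (4 * lam) := by
  have h1 : v ⬝ᵥ f = v ⬝ᵥ (K *ᵥ v) + lam * ∑ i, v i ^ 2 := by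
    rw [← hv, Matrix.add_mulVec, dotProduct_add, Matrix.smul_mulVec, Matrix.one_mulVec,
      dotProduct_smul, smul_eq_mul]
    simp [dotProduct, sq]
  have h2 : 2 * (v ⬝ᵥ f) = ∑ i, v i + ∑ i, (2 * f i - 1) * v i := by
    simp only [dotProduct, Finset.mul_sum, ← Finset.sum_add_distrib]
    refine Finset.sum_congr rfl fun j _ => ?_
    ring
  have h3 : ∑ i, (2 * f i - 1) * v i ≤ ∑ i : Fin n, (1 / (4 * lam) + lam * v i ^ 2) := by
    refine Finset.sum_le_sum fun i _ => ?_
    have : 1 / (4 * lam) + lam * v i ^ 2 - (2 * f i - 1) * v i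
        = lam * (v i - (2 * f i - 1) / (2 * lam)) ^ 2 := by
      have : (2 * f i - 1) ^ 2 = 1 := by rcases hf i with h | h <;> rw [h] <;> norm_num
      field_simp
      linear_combination (-4) * this
    have h0 : 0 ≤ lam * (v i - (2 * f i - 1) / (2 * lam)) ^ 2 := by positivity
    linarith
  rw [Finset.sum_add_distrib, ← Finset.mul_sum] at h3
  simp only [Finset.sum_const, Finset.card_univ, Fintype.card_fin, nsmul_eq_mul] at h3
  have h4 := hq v
  have h5 : (n:ℝ) * (1 / (4 * lam)) = n / (4 * lam) := by ring
  rw [dotProduct_comm]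
  nlinarith [sq_nonneg (∑ i, v i - 1)]

lemma whiten {K : Matrix (Fin n) (Fin n) ℝ} (hH : K.PosSemidef) (hK1 : ∀ i, K i i = 1)
    {lam : ℝ} (hlam : 0 < lam) : ∃ (R : Matrix (Fin n) (Fin n) ℝ) (c : Fin n → ℝ),
    Rᵀ * (K + lam • (1 : Matrix (Fin n) (Fin n) ℝ)) * R = 1 ∧ Rᵀ * K * R = diagonal c ∧
    (∀ i, 0 ≤ c i) ∧ (∀ i, c i ≤ n / (n + lam)) ∧ n / (n + lam) ≤ ∑ i, c i ∧
    ∑ i, c i = statDim K lam := by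
  obtain ⟨V, p, h⟩ := exists_rep hH.1
  have hp0 := h.psd_iff.1 hH
  have htr : ∑ i, p i = n := by
    rw [← h.trace]; simp [Matrix.trace, hK1]
  have hpn : ∀ i, p i ≤ n := fun i => by
    rw [← htr]; exact Finset.single_le_sum (fun i _ => hp0 i) (Finset.mem_univ i)
  have hpos : ∀ i, 0 < p i + lam := fun i => by linarith [hp0 i]
  set g : Fin n → ℝ := fun i => (Real.sqrt (p i + lam))⁻¹ with hg
  have hgg : ∀ i, g i * g i = (p i + lam)⁻¹ := fun i => by
    simp only [hg]
    rw [← mul_inv, Real.mul_self_sqrt (hpos i).le]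
  have hconj : ∀ (A : Matrix (Fin n) (Fin n) ℝ) q, IsRep A V q →
      (V * diagonal g)ᵀ * A * (V * diagonal g) = diagonal (fun i => q i / (p i + lam)) := by
    intro A q hA
    rw [hA.eq, Matrix.transpose_mul, Matrix.diagonal_transpose]
    have : diagonal g * Vᵀ * (V * diagonal q * Vᵀ) * (V * diagonal g)
        = diagonal g * (Vᵀ * V) * diagonal q * (Vᵀ * V) * diagonal g := by
      simp only [Matrix.mul_assoc]
    rw [this, hA.h1]
    simp only [Matrix.mul_one, Matrix.diagonal_mul_diagonal]
    congr 1; ext i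
    rw [div_eq_mul_inv, ← hgg]; ring
  have e1 := hconj _ _ (h.add (h.one.smul lam))
  have e2 := hconj _ _ h
  have e1' : (V * diagonal g)ᵀ * (K + lam • (1 : Matrix (Fin n) (Fin n) ℝ)) * (V * diagonal g) = 1 := by
    rw [e1, ← Matrix.diagonal_one]
    congr 1; ext i
    rw [mul_one, div_self (hpos i).ne']
  refine ⟨V * diagonal g, _, e1', e2, fun i => div_nonneg (hp0 i) (hpos i).le, fun i => ?_, ?_, ?_⟩
  · rw [div_le_div_iff₀ (hpos i) (by linarith [hp0 i, hpn i])]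
    nlinarith [hpn i]
  · calc (n:ℝ) / (n + lam) = ∑ i, p i / (n + lam) := by rw [← Finset.sum_div, htr]
      _ ≤ _ := Finset.sum_le_sum fun i _ => by
        have := hpn i
        exact div_le_div_of_nonneg_left (hp0 i) (hpos i) (by linarith)
  · rw [statDim]
    have hinv : (K + lam • (1 : Matrix (Fin n) (Fin n) ℝ))⁻¹ = (V * diagonal g) * (V * diagonal g)ᵀ := by
      apply Matrix.inv_eq_right_inv
      rw [← Matrix.mul_assoc]
      rw [Matrix.mul_assoc] at e1'
      exact mul_eq_one_comm.1 e1'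
    rw [hinv, ← Matrix.mul_assoc, Matrix.trace_mul_comm, ← Matrix.mul_assoc, e2, Matrix.trace_diagonal]

end CorePart

section MainPart
variable {n : ℕ} {J : Type*} [Fintype J]

/-- The good event on sign patterns. -/
def GoodPat (K : Matrix (Fin n) (Fin n) ℝ) (lam ε : ℝ) (f : J → Fin n → ℝ) {m : ℕ}
    (ω : Fin m → J) : Prop :=
  Loewner ((1 - ε) • (K + lam • 1))
    ((2 / (m : ℝ)) • (∑ r, vecMulVec (f (ω r)) (f (ω r))) + lam • 1) ∧
  Loewner ((2 / (m : ℝ)) • (∑ r, vecMulVec (f (ω r)) (f (ω r))) + lam • 1)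
    ((1 + ε) • (K + lam • 1))

lemma conj_psd {R A : Matrix (Fin n) (Fin n) ℝ} (hR : IsUnit R) (h : (Rᵀ * A * R).PosSemidef) :
    A.PosSemidef := by
  have := Matrix.IsUnit.posSemidef_star_left_conjugate_iff hR (x := A)
  simp only [star_eq_conjTranspose, Matrix.conjTranspose_eq_transpose_of_trivial] at this
  exact this.1 h

lemma rank_one_le {z : Fin n → ℝ} {L : ℝ} (hz : 2 * (z ⬝ᵥ z) ≤ L) :
    (L • (1 : Matrix (Fin n) (Fin n) ℝ) - (2 : ℝ) • vecMulVec z z).PosSemidef := by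
  refine Matrix.PosSemidef.of_dotProduct_mulVec_nonneg ?_ ?_
  · ext i j
    simp [vecMulVec_apply, Matrix.one_apply, eq_comm, mul_comm]
  · intro y
    have h := Finset.sum_mul_sq_le_sq_mul_sq Finset.univ z y
    have e : star y ⬝ᵥ ((L • (1 : Matrix (Fin n) (Fin n) ℝ) - (2 : ℝ) • vecMulVec z z) *ᵥ y)
        = L * (∑ i, y i ^ 2) - 2 * (∑ i, z i * y i) ^ 2 := by
      rw [Matrix.sub_mulVec, dotProduct_sub, Matrix.smul_mulVec, Matrix.one_mulVec,
        Matrix.smul_mulVec, Matrix.vecMulVec_mulVec, op_smul_eq_smul]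
      simp only [star_trivial, dotProduct_smul, smul_eq_mul, dotProduct_comm y z]
      simp only [dotProduct, sq]
    rw [e]
    have hzz : z ⬝ᵥ z = ∑ i, z i ^ 2 := by simp [dotProduct, sq]
    rw [hzz] at hz
    have hy : 0 ≤ ∑ i, y i ^ 2 := Finset.sum_nonneg fun i _ => sq_nonneg _
    nlinarith [mul_le_mul_of_nonneg_right hz hy]

set_option maxHeartbeats 1000000 in
open Classical in
lemma core {pr : J → ℝ} (hpr : ∀ j, 0 ≤ pr j) (hsum : ∑ j, pr j = 1) {f : J → Fin n → ℝ}
    (hf : ∀ j i, f j i = 0 ∨ f j i = 1) {K : Matrix (Fin n) (Fin n) ℝ}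
    (hK : K = ∑ j, pr j • (2 : ℝ) • vecMulVec (f j) (f j)) (hK1 : ∀ i, K i i = 1)
    {lam ε δ : ℝ} (hlam : 0 < lam) (hlamn : lam ≤ n) (he0 : 0 < ε) (he1 : ε < 1 / 2)
    (hd0 : 0 < δ) (hd1 : δ < 1) (m : ℕ)
    (hm : (8 / 3) * ((n : ℝ) / (lam * ε ^ 2)) * Real.log (16 * statDim K lam / δ) ≤ (m : ℝ)) :
    (∑ ω : Fin m → J, if GoodPat K lam ε f ω then 0 else ∏ i, pr (ω i)) ≤ δ := by
  have hq := quad_lower hpr hsum hf hK hK1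
  have hvv : ∀ z : Fin n → ℝ, (vecMulVec z z).PosSemidef := fun z => by
    simpa using Matrix.posSemidef_vecMulVec_self_star z
  have hpsd : K.PosSemidef := by
    rw [hK]
    exact Matrix.posSemidef_sum _ fun j _ =>
      ((hvv _).smul (by norm_num : (0:ℝ) ≤ 2)).smul (hpr j)
  obtain ⟨R, c, hG, hC, hc0, hcm, hcs, hs⟩ := whiten hpsd hK1 hlam
  set G := K + lam • (1 : Matrix (Fin n) (Fin n) ℝ) with hGdef
  set N := (n : ℝ) / lam with hN
  have hn0 : (0:ℝ) < n := by linarith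
  have hN1 : 1 ≤ N := by rw [hN, one_le_div hlam]; exact hlamn
  have hcmN : (n : ℝ) / (n + lam) = N / (N + 1) := by rw [hN]; field_simp
  rw [hcmN] at hcs
  simp only [hcmN] at hcm
  set cm := N / (N + 1) with hcmdef
  set L := N / 2 + 1 with hLdef
  have hL0 : 0 < L := by positivity
  have hcm2 : 1 / 2 ≤ cm := by rw [hcmdef, div_le_div_iff₀ (by norm_num) (by linarith)]; linarith
  have hGRR : G * R * Rᵀ = 1 := by
    rw [Matrix.mul_assoc] at hG
    exact mul_eq_one_comm.1 hG
  have hRu : IsUnit R := by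
    refine ⟨⟨R, Rᵀ * G, mul_eq_one_comm.1 hG, hG⟩, rfl⟩
  set Z : J → Matrix (Fin n) (Fin n) ℝ := fun j => (2 : ℝ) • vecMulVec (Rᵀ *ᵥ f j) (Rᵀ *ᵥ f j) with hZdef
  have hZ2 : ∀ j, Z j = Rᵀ * ((2 : ℝ) • vecMulVec (f j) (f j)) * R := by
    intro j
    simp only [hZdef]
    rw [Matrix.mul_smul, Matrix.smul_mul, Matrix.mul_vecMulVec, Matrix.vecMulVec_mul,
      Matrix.mulVec_transpose]
  have hZ : ∀ j, (Z j).PosSemidef := fun j => (hvv _).smul (by norm_num : (0:ℝ) ≤ 2)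
  have hZL : ∀ j, (L • (1 : Matrix (Fin n) (Fin n) ℝ) - Z j).PosSemidef := by
    intro j
    refine rank_one_le ?_
    have h1 := norm_bound hq hlam (hf j) (v := R *ᵥ (Rᵀ *ᵥ f j)) (by
      rw [Matrix.mulVec_mulVec, Matrix.mulVec_mulVec]
      rw [hGdef] at hGRR
      rw [hGRR, Matrix.one_mulVec])
    rw [Matrix.dotProduct_mulVec, ← Matrix.mulVec_transpose] at h1
    have e : (n:ℝ) / (4 * lam) = N / 4 := by rw [hN]; ring
    rw [e] at h1
    rw [hLdef]; linarith
  have hZC : ∑ j, pr j • Z j = diagonal c := by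
    rw [← hC, hK, Matrix.mul_sum, Matrix.sum_mul]
    refine Finset.sum_congr rfl fun j _ => ?_
    rw [hZ2, Matrix.mul_smul Rᵀ (pr j), Matrix.smul_mul (pr j)]
  have hs2 : 1 / 2 ≤ statDim K lam := by rw [← hs]; linarith
  have hM' : (8 / 3) * (N / ε ^ 2) * Real.log (16 * statDim K lam / δ) ≤ (m : ℝ) := by
    rw [hN, div_div]; exact hm
  have hlog : 0 < Real.log (16 * statDim K lam / δ) := by
    apply Real.log_pos
    rw [lt_div_iff₀ hd0]; linarith
  have hm0 : (0:ℝ) < m := lt_of_lt_of_le (by positivity) hM'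
  set u := ε / (cm + ε / 3) with hu
  have hu0 : 0 < u := by positivity
  set x := u * m * ε / L with hx
  have hx0 : 0 ≤ x := by positivity
  have key : ∀ θ : ℝ, (θ * L = u ∨ θ * L = -u) →
    (∑ ω : Fin m → J, if (x • (1 : Matrix (Fin n) (Fin n) ℝ) -
        θ • (∑ i, Z (ω i) - (m : ℝ) • diagonal c)).PosSemidef then 0 else ∏ i, pr (ω i)) ≤ δ / 4 := by
    intro θ hθ
    have h := conc_one hpr hsum (θ := θ) hL0 hZ hZL hZC (by linarith : 0 < cm) hc0 hcm hx0 m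
    rw [hs] at h
    exact numer hN1 he0 he1 hcmdef hLdef hu hs2 hd0 hd1 hM' hx hθ h
  have k1 := key (u / L) (Or.inl (by field_simp))
  have k2 := key (-(u / L)) (Or.inr (by field_simp))
  have hGC : Rᵀ * G * R - Rᵀ * K * R = lam • (Rᵀ * R) := by
    rw [← Matrix.sub_mul, ← Matrix.mul_sub, hGdef, add_sub_cancel_left, Matrix.mul_smul,
      Matrix.smul_mul, Matrix.mul_one]
  rw [hG, hC] at hGC
  have hS : ∀ ω : Fin m → J, Rᵀ * ((2 / (m : ℝ)) • (∑ r, vecMulVec (f (ω r)) (f (ω r))) + lam • 1) * R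
      = (m:ℝ)⁻¹ • ∑ i, Z (ω i) + (1 - diagonal c) := by
    intro ω
    rw [hGC, Matrix.mul_add, Matrix.add_mul, Matrix.mul_smul Rᵀ lam,
      Matrix.smul_mul lam, Matrix.mul_one]
    congr 1
    simp only [hZ2, Matrix.mul_smul, Matrix.smul_mul, Matrix.mul_sum, Matrix.sum_mul,
      ← Finset.smul_sum, smul_smul]
    congr 1; ring
  have hgood : ∀ ω : Fin m → J,
      (x • (1 : Matrix (Fin n) (Fin n) ℝ) -
        (u / L) • (∑ i, Z (ω i) - (m : ℝ) • diagonal c)).PosSemidef →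
      (x • (1 : Matrix (Fin n) (Fin n) ℝ) -
        (-(u / L)) • (∑ i, Z (ω i) - (m : ℝ) • diagonal c)).PosSemidef → GoodPat K lam ε f ω := by
    intro ω g1 g2
    have hpos : 0 ≤ (L / (u * m)) := by positivity
    have a1 := g1.smul hpos
    have a2 := g2.smul hpos
    have ex : L / (u * m) * x = ε := by rw [hx]; field_simp
    have et : L / (u * m) * (u / L) = (m:ℝ)⁻¹ := by field_simp
    have et2 : (m:ℝ)⁻¹ * m = 1 := by field_simp
    rw [smul_sub, smul_smul, smul_smul, ex] at a1 a2
    rw [mul_neg] at a2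
    rw [et, neg_smul] at a2
    rw [et] at a1
    rw [smul_sub, smul_smul, et2, one_smul] at a1 a2
    refine ⟨conj_psd hRu ?_, conj_psd hRu ?_⟩
    · rw [Matrix.mul_sub, Matrix.sub_mul, hS, Matrix.mul_smul, Matrix.smul_mul, hG]
      convert a2 using 1
      module
    · rw [Matrix.mul_sub, Matrix.sub_mul, hS, Matrix.mul_smul, Matrix.smul_mul, hG]
      convert a1 using 1
      module
  refine le_trans (Finset.sum_le_sum (g := fun ω => (if (x • (1 : Matrix (Fin n) (Fin n) ℝ) -
        (u / L) • (∑ i, Z (ω i) - (m : ℝ) • diagonal c)).PosSemidef then 0 else ∏ i, pr (ω i)) +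
        (if (x • (1 : Matrix (Fin n) (Fin n) ℝ) -
        (-(u / L)) • (∑ i, Z (ω i) - (m : ℝ) • diagonal c)).PosSemidef then 0 else ∏ i, pr (ω i)))
        fun ω _ => ?_) ?_
  · have hp : 0 ≤ ∏ i, pr (ω i) := Finset.prod_nonneg fun i _ => hpr _
    by_cases g1 : (x • (1 : Matrix (Fin n) (Fin n) ℝ) -
        (u / L) • (∑ i, Z (ω i) - (m : ℝ) • diagonal c)).PosSemidef
    · by_cases g2 : (x • (1 : Matrix (Fin n) (Fin n) ℝ) -
        (-(u / L)) • (∑ i, Z (ω i) - (m : ℝ) • diagonal c)).PosSemidef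
      · rw [if_pos (hgood ω g1 g2), if_pos g1, if_pos g2]; norm_num
      · rw [if_pos g1, if_neg g2]; split_ifs <;> linarith
    · rw [if_neg g1]; split_ifs <;> linarith
  · rw [Finset.sum_add_distrib]
    linarith
end MainPart

section PatPart
variable {d n : ℕ}

/-- One standard Gaussian vector. -/
noncomputable def gvec (d : ℕ) : Measure (Fin d → ℝ) := Measure.pi fun _ => gaussianReal 0 1

instance gvec_prob (d : ℕ) : IsProbabilityMeasure (gvec d) := by
  unfold gvec; infer_instance

/-- Sign pattern. -/
noncomputable def pat (X : Matrix (Fin d) (Fin n) ℝ) (w : Fin d → ℝ) : Fin n → Bool :=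
  fun i => decide (0 < ∑ k, w k * X k i)

lemma pat_meas (X : Matrix (Fin d) (Fin n) ℝ) : Measurable (pat X) := by
  refine measurable_pi_lambda _ fun i => measurable_to_bool ?_
  have : (fun w => pat X w i) ⁻¹' {true} = {w | 0 < ∑ k, w k * X k i} := by
    ext w; simp [pat]
  rw [this]
  exact measurableSet_lt measurable_const (by fun_prop)

/-- Indicator vector of a pattern. -/
def fpat (j : Fin n → Bool) (i : Fin n) : ℝ := if j i = true then 1 else 0

lemma colNorm_pos {X : Matrix (Fin d) (Fin n) ℝ} (hX : ∀ i, (fun k => X k i) ≠ 0) (i : Fin n) :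
    0 < colNorm X i := by
  refine Real.sqrt_pos.2 ?_
  obtain ⟨k, hk⟩ := Function.ne_iff.1 (hX i)
  have : 0 < X k i ^ 2 := by simp at hk; positivity
  exact lt_of_lt_of_le this
    (Finset.single_le_sum (f := fun k => X k i ^ 2) (fun _ _ => sq_nonneg _) (Finset.mem_univ k))

lemma colNorm_sq (X : Matrix (Fin d) (Fin n) ℝ) (i : Fin n) :
    colNorm X i ^ 2 = ∑ k, X k i ^ 2 :=
  Real.sq_sqrt (Finset.sum_nonneg fun _ _ => sq_nonneg _)

lemma orthant_col {X : Matrix (Fin d) (Fin n) ℝ} (hX : ∀ i, (fun k => X k i) ≠ 0) (i j : Fin n) :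
    (gvec d).real {w | 0 < ∑ k, w k * X k i ∧ 0 < ∑ k, w k * X k j} = K0mat X i j / 2 := by
  have hp := colNorm_pos hX
  have hu : ∀ i, ∑ k, (X k i / colNorm X i) ^ 2 = 1 := fun i => by
    simp only [div_pow]
    rw [← Finset.sum_div, ← colNorm_sq, div_self (pow_pos (hp i) 2).ne']
  have h := orthant_unit _ _ (hu i) (hu j)
  have hs : ∀ (i : Fin n) (w : Fin d → ℝ), ∑ k, X k i / colNorm X i * w k = (∑ k, w k * X k i) / colNorm X i := by
    intro i w
    rw [Finset.sum_div]
    exact Finset.sum_congr rfl fun k _ => by ring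
  have hi : ∑ k, X k i / colNorm X i * (X k j / colNorm X j)
      = colInner X i j / (colNorm X i * colNorm X j) := by
    rw [colInner, Finset.sum_div]
    exact Finset.sum_congr rfl fun k _ => by rw [div_mul_div_comm]
  rw [hi] at h
  simp only [hs] at h
  have hset : {w : Fin d → ℝ | 0 < ∑ k, w k * X k i ∧ 0 < ∑ k, w k * X k j} =
      {w | 0 < (∑ k, w k * X k i) / colNorm X i ∧ 0 < (∑ k, w k * X k j) / colNorm X j} := by
    ext w
    show (_ ∧ _) ↔ (_ ∧ _)
    rw [div_pos_iff_of_pos_right (hp i), div_pos_iff_of_pos_right (hp j)]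
  rw [hset, Measure.real, gvec, h, ENNReal.toReal_ofReal]
  · simp only [K0mat, Matrix.of_apply, kappa0]
    field_simp
  · have := Real.arccos_le_pi (colInner X i j / (colNorm X i * colNorm X j))
    have := Real.pi_pos
    apply div_nonneg <;> linarith

lemma K0_diag {X : Matrix (Fin d) (Fin n) ℝ} (hX : ∀ i, (fun k => X k i) ≠ 0) (i : Fin n) :
    K0mat X i i = 1 := by
  have hp := colNorm_pos hX i
  have : colInner X i i = colNorm X i * colNorm X i := by
    rw [← sq, colNorm_sq, colInner]
    exact Finset.sum_congr rfl fun k _ => by ring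
  simp only [K0mat, Matrix.of_apply, kappa0]
  rw [this, div_self (mul_pos hp hp).ne']
  simp [Real.pi_ne_zero]

lemma K0_bd (X : Matrix (Fin d) (Fin n) ℝ) (i j : Fin n) : K0mat X i j ^ 2 ≤ 1 := by
  simp only [K0mat, Matrix.of_apply, kappa0]
  have h1 := Real.arccos_le_pi (colInner X i j / (colNorm X i * colNorm X j))
  have h2 := Real.arccos_nonneg (colInner X i j / (colNorm X i * colNorm X j))
  have h3 := Real.pi_pos
  have h4 : 1 / Real.pi * (Real.pi - Real.arccos (colInner X i j / (colNorm X i * colNorm X j))) ≤ 1 := by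
    rw [one_div_mul_eq_div, div_le_one h3]; linarith
  have h5 : 0 ≤ 1 / Real.pi * (Real.pi - Real.arccos (colInner X i j / (colNorm X i * colNorm X j))) :=
    mul_nonneg (by positivity) (by linarith)
  nlinarith

lemma K0_norm (X : Matrix (Fin d) (Fin n) ℝ) : l2OpNorm (K0mat X) ≤ n := by
  refine ContinuousLinearMap.opNorm_le_bound _ (by positivity) fun v => ?_
  rw [LinearMap.coe_toContinuousLinearMap']
  refine abs_le_of_sq_le_sq' ?_ (by positivity) |>.2
  rw [mul_pow, EuclideanSpace.norm_sq_eq, EuclideanSpace.norm_sq_eq]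
  have : ∀ i, ‖(Matrix.toEuclideanLin (K0mat X) v) i‖ ^ 2 ≤ n * ∑ k, ‖v k‖ ^ 2 := by
    intro i
    have e : (Matrix.toEuclideanLin (K0mat X) v) i = ∑ k, K0mat X i k * v k := by
      simp [Matrix.toEuclideanLin_apply, Matrix.mulVec, dotProduct]
    rw [e]
    simp only [Real.norm_eq_abs, sq_abs]
    refine (Finset.sum_mul_sq_le_sq_mul_sq _ _ _).trans ?_
    gcongr
    calc _ ≤ ∑ _k : Fin n, (1:ℝ) := Finset.sum_le_sum fun k _ => K0_bd X i k
      _ = n := by simp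
  calc _ ≤ ∑ _i : Fin n, n * ∑ k, ‖v k‖ ^ 2 := Finset.sum_le_sum fun i _ => this i
    _ = _ := by simp; ring

/-- Pattern law. -/
noncomputable def plaw (X : Matrix (Fin d) (Fin n) ℝ) : Measure (Fin n → Bool) := (gvec d).map (pat X)

instance plaw_prob (X : Matrix (Fin d) (Fin n) ℝ) : IsProbabilityMeasure (plaw X) :=
  Measure.isProbabilityMeasure_map (pat_meas X).aemeasurable

lemma plaw_sum (X : Matrix (Fin d) (Fin n) ℝ) : ∑ j, (plaw X).real {j} = 1 := by
  rw [sum_measureReal_singleton]; simp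

lemma K0_eq {X : Matrix (Fin d) (Fin n) ℝ} (hX : ∀ i, (fun k => X k i) ≠ 0) :
    K0mat X = ∑ j, (plaw X).real {j} • (2 : ℝ) • vecMulVec (fpat j) (fpat j) := by
  ext i k
  have h : (plaw X).real {j | j i = true ∧ j k = true} = K0mat X i k / 2 := by
    rw [plaw, map_measureReal_apply (pat_meas X) (Set.toFinite _).measurableSet, ← orthant_col hX]
    congr 1
    ext w
    simp [pat]
  have h2 : (plaw X).real {j | j i = true ∧ j k = true}
      = ∑ j with (j i = true ∧ j k = true), (plaw X).real {j} := by
    rw [sum_measureReal_singleton]; simp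
  rw [h, Finset.sum_filter] at h2
  have h3 : K0mat X i k = 2 * (K0mat X i k / 2) := by ring
  rw [h3, h2, Finset.mul_sum]
  simp only [Matrix.sum_apply, Matrix.smul_apply, vecMulVec_apply, smul_eq_mul]
  refine Finset.sum_congr rfl fun j _ => ?_
  by_cases a : j i = true <;> by_cases b : j k = true <;> simp [fpat, a, b, mul_comm]

lemma Phi_eq (X : Matrix (Fin d) (Fin n) ℝ) (m : ℕ) (W : Fin m → Fin d → ℝ) :
    (Phi0 X m W)ᵀ * Phi0 X m W
      = (2 / (m : ℝ)) • ∑ r, vecMulVec (fpat (pat X (W r))) (fpat (pat X (W r))) := by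
  ext i k
  simp only [Matrix.mul_apply, Matrix.transpose_apply, Matrix.smul_apply, Matrix.sum_apply,
    vecMulVec_apply, smul_eq_mul, Finset.mul_sum, Phi0, Matrix.of_apply]
  refine Finset.sum_congr rfl fun r _ => ?_
  have : Real.sqrt (2 / (m : ℝ)) * Real.sqrt (2 / (m : ℝ)) = 2 / m :=
    Real.mul_self_sqrt (by positivity)
  have e : ∀ i, step (∑ k, W r k * X k i) = fpat (pat X (W r)) i := by
    intro i; simp [step, fpat, pat]
  rw [e, e]
  linear_combination (fpat (pat X (W r)) i * fpat (pat X (W r)) k) * this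

open Classical in
lemma law_event (X : Matrix (Fin d) (Fin n) ℝ) (m : ℕ) (P : (Fin m → Fin n → Bool) → Prop) {δ : ℝ}
    (h : (∑ ω : Fin m → Fin n → Bool, if P ω then 0 else ∏ i, (plaw X).real {ω i}) ≤ δ) :
    ENNReal.ofReal (1 - δ) ≤ gaussMat m d {W | P fun r => pat X (W r)} := by
  have hmp : (gaussMat m d).map (fun W r => pat X (W r)) = Measure.pi fun _ => plaw X := by
    have := Measure.pi_map_pi (μ := fun _ : Fin m => gvec d) (f := fun _ => pat X)
      (fun _ => (pat_meas X).aemeasurable)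
    exact this
  have hmeas : Measurable (fun (W : Fin m → Fin d → ℝ) r => pat X (W r)) :=
    measurable_pi_lambda _ fun r => (pat_meas X).comp (measurable_pi_apply r)
  have e : gaussMat m d {W | P fun r => pat X (W r)} = (Measure.pi fun _ : Fin m => plaw X) {ω | P ω} := by
    rw [← hmp, Measure.map_apply hmeas (Set.toFinite _).measurableSet]
    rfl
  rw [e]
  set ν := Measure.pi fun _ : Fin m => plaw X with hν
  have hc : ν.real {ω | P ω}ᶜ ≤ δ := by
    refine le_trans (le_of_eq ?_) h
    have h2 : ν.real {ω | P ω}ᶜ = ∑ ω with ¬ P ω, ν.real {ω} := by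
      rw [sum_measureReal_singleton]; congr 1; ext ω; simp
    rw [h2, Finset.sum_filter]
    refine Finset.sum_congr rfl fun ω _ => ?_
    have : ν.real {ω} = ∏ i, (plaw X).real {ω i} := by
      rw [hν, Measure.real, Measure.pi_singleton, ENNReal.toReal_prod]; rfl
    rw [this, ite_not]
  rw [measureReal_compl (Set.toFinite _).measurableSet] at hc
  simp at hc
  refine ENNReal.ofReal_le_of_le_toReal ?_
  have : ν.real {ω | P ω} = (ν {ω | P ω}).toReal := rfl
  linarith
end PatPart

theorem arccos0_features_spectral_approx (d n : ℕ) (X : Matrix (Fin d) (Fin n) ℝ)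
    (hX : ∀ i, (fun k => X k i) ≠ 0)
    (lam : ℝ) (hlam0 : 0 < lam) (hlam1 : lam < l2OpNorm (K0mat X))
    (ε δ : ℝ) (hε : ε ∈ Set.Ioo (0 : ℝ) (1 / 2)) (hδ : δ ∈ Set.Ioo (0 : ℝ) 1)
    (m : ℕ)
    (hm : (8 / 3) * ((n : ℝ) / (lam * ε ^ 2)) *
        Real.log (16 * statDim (K0mat X) lam / δ) ≤ (m : ℝ)) :
    ENNReal.ofReal (1 - δ) ≤
      gaussMat m d {W |
        Loewner ((1 - ε) • (K0mat X + lam • 1))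
          ((Phi0 X m W)ᵀ * Phi0 X m W + lam • 1) ∧
        Loewner ((Phi0 X m W)ᵀ * Phi0 X m W + lam • 1)
          ((1 + ε) • (K0mat X + lam • 1))} := by
  obtain ⟨he0, he1⟩ := hε
  obtain ⟨hd0, hd1⟩ := hδ
  have hc := core (pr := fun j => (plaw X).real {j}) (fun j => measureReal_nonneg) (plaw_sum X)
    (f := fpat) (fun j i => by unfold fpat; split_ifs <;> simp) (K0_eq hX) (K0_diag hX) hlam0
    (hlam1.le.trans (K0_norm X)) he0 he1 hd0 hd1 m hm
  have h := law_event X m (fun ω => GoodPat (K0mat X) lam ε fpat ω) hc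
  simp only [Phi_eq]
  exact h
end

section
/- Let X = [x1,…,xn] ∈ ℝ^{d×n} have nonzero columns and let K1 ∈ ℝ^{n×n} be its first-order arc-cosine kernel matrix. Then (1/2)·XᵀX ⪯ K1 in the Loewner order. -/
open MeasureTheory ProbabilityTheory Matrix

theorem psd_iff_aux {n : ℕ} (M : Matrix (Fin n) (Fin n) ℝ) :
    M.PosSemidef ↔ (∀ i j, M i j = M j i) ∧
      ∀ c : Fin n → ℝ, 0 ≤ ∑ i, ∑ j, c i * c j * M i j := by
  rw [Matrix.posSemidef_iff_dotProduct_mulVec]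
  have e : ∀ c : Fin n → ℝ, star c ⬝ᵥ (M *ᵥ c) = ∑ i, ∑ j, c i * c j * M i j := by
    intro c
    simp only [dotProduct, mulVec, Finset.mul_sum, Pi.star_apply, star_trivial]
    refine Finset.sum_congr rfl fun i _ => Finset.sum_congr rfl fun j _ => by ring
  simp only [e]
  refine and_congr_left fun _ => ?_
  constructor
  · intro h i j
    have := h.apply i j
    simpa using this.symm
  · intro h
    ext i j
    simpa using h j i

theorem psd_pow_aux {n : ℕ} {A : Matrix (Fin n) (Fin n) ℝ} (hA : A.PosSemidef) (k : ℕ) :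
    (Matrix.of fun i j => A i j ^ k).PosSemidef := by
  induction k with
  | zero =>
    rw [psd_iff_aux]
    refine ⟨by simp, fun c => ?_⟩
    have : ∑ i, ∑ j, c i * c j * (Matrix.of fun i j => A i j ^ 0) i j = (∑ i, c i) ^ 2 := by
      simp [sq, Finset.sum_mul_sum]
    rw [this]; positivity
  | succ k ih =>
    have := ih.hadamard hA
    have e : (Matrix.of fun i j => A i j ^ (k + 1)) = (Matrix.of fun i j => A i j ^ k) ⊙ A := by
      ext i j
      simp [Matrix.hadamard_apply, pow_succ]
    rw [e]
    exact this

theorem psd_series_aux {n : ℕ} {A B : Matrix (Fin n) (Fin n) ℝ} (hA : A.PosSemidef)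
    (a : ℕ → ℝ) (p : ℕ → ℕ) (ha : ∀ k, 0 ≤ a k)
    (h : ∀ i j, HasSum (fun k => a k * A i j ^ p k) (B i j)) : B.PosSemidef := by
  rw [psd_iff_aux]
  have hs := ((psd_iff_aux A).1 hA).1
  refine ⟨fun i j => (h i j).unique (by rw [hs i j]; exact h j i), fun c => ?_⟩
  have H : HasSum (fun k => ∑ i, ∑ j, c i * c j * (a k * A i j ^ p k))
      (∑ i, ∑ j, c i * c j * B i j) :=
    hasSum_sum fun i _ => hasSum_sum fun j _ => (h i j).mul_left _
  refine H.nonneg fun k => ?_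
  have := ((psd_iff_aux _).1 (psd_pow_aux hA (p k))).2 c
  have e : ∑ i, ∑ j, c i * c j * (a k * A i j ^ p k)
      = a k * ∑ i, ∑ j, c i * c j * (Matrix.of fun i j => A i j ^ p k) i j := by
    simp only [Finset.mul_sum, Matrix.of_apply]
    refine Finset.sum_congr rfl fun i _ => Finset.sum_congr rfl fun j _ => by ring
  rw [e]
  exact mul_nonneg (ha k) this

theorem psd_invsqrt_aux {n : ℕ} {A : Matrix (Fin n) (Fin n) ℝ} (hA : A.PosSemidef)
    (h1 : ∀ i j, |A i j| < 1) :
    (Matrix.of fun i j => 1 / √(1 - A i j)).PosSemidef := by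
  have hL : (Matrix.of fun i j => (1 / 2) * (-Real.log (1 - A i j))).PosSemidef := by
    refine psd_series_aux hA (fun k => (1 / 2) * (1 / ((k : ℝ) + 1))) (fun k => k + 1)
      (fun k => by positivity) fun i j => ?_
    have h := (Real.hasSum_pow_div_log_of_abs_lt_one (h1 i j)).mul_left (1 / 2)
    have e : (fun k : ℕ => (1 / 2) * (1 / ((k : ℝ) + 1)) * A i j ^ (k + 1)) =
        fun k : ℕ => (1 / 2) * (A i j ^ (k + 1) / ((k : ℝ) + 1)) := by
      funext k; ring
    rw [Matrix.of_apply, e]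
    exact h
  refine psd_series_aux hL (fun k => 1 / (k.factorial : ℝ)) (fun k => k)
      (fun k => by positivity) fun i j => ?_
  have := NormedSpace.expSeries_div_hasSum_exp ((1 / 2) * (-Real.log (1 - A i j)) : ℝ)
  rw [← Real.exp_eq_exp_ℝ] at this
  have hp : 0 < 1 - A i j := by have := (abs_lt.1 (h1 i j)).2; linarith
  have e : (fun k : ℕ => 1 / (k.factorial : ℝ) * ((1 / 2) * (-Real.log (1 - A i j))) ^ k) =
      fun k : ℕ => ((1 / 2) * (-Real.log (1 - A i j))) ^ k / (k.factorial : ℝ) := by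
    funext k; ring
  have e2 : 1 / √(1 - A i j) = Real.exp ((1 / 2) * (-Real.log (1 - A i j))) := by
    rw [mul_neg, Real.exp_neg, one_div_mul_eq_div, Real.exp_half, Real.exp_log hp, one_div]
  simp only [Matrix.of_apply]
  rw [e, e2]
  exact this

theorem mono_aux {f f' : ℝ → ℝ} (hc : ContinuousOn f (Set.Icc 0 1))
    (hd : ∀ t ∈ Set.Ioo (0 : ℝ) 1, HasDerivAt f (f' t) t)
    (hn : ∀ t ∈ Set.Ioo (0 : ℝ) 1, 0 ≤ f' t) : MonotoneOn f (Set.Icc 0 1) := by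
  refine monotoneOn_of_deriv_nonneg (convex_Icc 0 1) hc ?_ ?_
  · rw [interior_Icc]
    exact fun t ht => (hd t ht).differentiableAt.differentiableWithinAt
  · rw [interior_Icc]
    intro t ht
    rw [(hd t ht).deriv]; exact hn t ht

theorem bd_aux {a t : ℝ} (ha : |a| ≤ 1) (ht : t ∈ Set.Ioo (0 : ℝ) 1) : |t * a| < 1 := by
  rw [abs_mul, abs_of_pos ht.1]
  nlinarith [ht.1, ht.2, abs_nonneg a]

theorem quad_aux {n : ℕ} {A : Matrix (Fin n) (Fin n) ℝ} (hA : A.PosSemidef)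
    (h1 : ∀ i j, |A i j| ≤ 1) (c : Fin n → ℝ) :
    0 ≤ ∑ i, ∑ j, c i * c j * (√(1 - A i j ^ 2) + A i j * Real.arcsin (A i j)) := by
  have ne : ∀ t ∈ Set.Ioo (0 : ℝ) 1, ∀ i j, t * A i j ≠ -1 ∧ t * A i j ≠ 1 := by
    intro t ht i j
    have := abs_lt.1 (bd_aux (h1 i j) ht)
    exact ⟨this.1.ne', this.2.ne⟩
  have m1 : MonotoneOn (fun t => ∑ i, ∑ j, c i * c j * (A i j * Real.arcsin (t * A i j)))
      (Set.Icc 0 1) := by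
    refine mono_aux (f' := fun t => ∑ i, ∑ j, c i * c j *
      (A i j * (1 / √(1 - (t * A i j) ^ 2) * (1 * A i j)))) ?_ ?_ ?_
    · refine Continuous.continuousOn ?_
      fun_prop
    · intro t ht
      refine HasDerivAt.fun_sum fun i _ => HasDerivAt.fun_sum fun j _ => ?_
      refine HasDerivAt.const_mul _ (HasDerivAt.const_mul _ ?_)
      exact (Real.hasDerivAt_arcsin (ne t ht i j).1 (ne t ht i j).2).comp t
        ((hasDerivAt_id t).mul_const _)
    · intro t ht
      have hB : (Matrix.of fun i j => (t * A i j) ^ 2).PosSemidef :=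
        psd_pow_aux (A := t • A) (hA.smul ht.1.le) 2
      have hS := psd_invsqrt_aux hB (by
        intro i j
        have := bd_aux (h1 i j) ht
        rw [Matrix.of_apply, abs_pow]
        exact pow_lt_one₀ (abs_nonneg _) this (by norm_num))
      have := ((psd_iff_aux _).1 ((hA.hadamard hS).hadamard hA)).2 c
      simpa [Matrix.hadamard_apply, mul_assoc] using this
  have p1 : ∀ t ∈ Set.Icc (0 : ℝ) 1,
      0 ≤ ∑ i, ∑ j, c i * c j * (A i j * Real.arcsin (t * A i j)) := by
    intro t ht
    have := m1 (Set.left_mem_Icc.2 zero_le_one) ht ht.1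
    simpa using this
  have m2 : MonotoneOn (fun t => ∑ i, ∑ j, c i * c j *
      (√(1 - (t * A i j) ^ 2) + (t * A i j) * Real.arcsin (t * A i j))) (Set.Icc 0 1) := by
    refine mono_aux (f' := fun t => ∑ i, ∑ j, c i * c j *
      (A i j * Real.arcsin (t * A i j))) ?_ ?_ fun t ht => p1 t ⟨ht.1.le, ht.2.le⟩
    · refine Continuous.continuousOn ?_
      fun_prop
    · intro t ht
      refine HasDerivAt.fun_sum fun i _ => HasDerivAt.fun_sum fun j _ => ?_
      refine HasDerivAt.const_mul _ ?_
      have hl : HasDerivAt (fun t => t * A i j) (1 * A i j) t := (hasDerivAt_id t).mul_const _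
      have ha : HasDerivAt (fun t => Real.arcsin (t * A i j))
          (1 / √(1 - (t * A i j) ^ 2) * (1 * A i j)) t :=
        HasDerivAt.comp (h₂ := Real.arcsin) t
          (Real.hasDerivAt_arcsin (ne t ht i j).1 (ne t ht i j).2) hl
      have hb := abs_lt.1 (bd_aux (h1 i j) ht)
      have hp : 0 < 1 - (t * A i j) ^ 2 := by nlinarith
      have hq := ((hl.pow 2).const_sub 1).sqrt hp.ne'
      have := hq.add (hl.mul ha)
      have hne : √(1 - (t * A i j) ^ 2) ≠ 0 := (Real.sqrt_pos.2 hp).ne'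
      refine HasDerivAt.congr_deriv this ?_
      simp only [Pi.pow_apply]
      field_simp
      ring
  have := m2 (Set.left_mem_Icc.2 zero_le_one) (Set.right_mem_Icc.2 zero_le_one) zero_le_one
  simp only [one_mul] at this
  refine le_trans ?_ this
  have e : ∑ i, ∑ j, c i * c j * (√(1 - (0 * A i j) ^ 2) + (0 * A i j) * Real.arcsin (0 * A i j))
      = (∑ i, c i) ^ 2 := by
    simp [sq, Finset.sum_mul_sum]
  rw [e]; positivity

theorem half_gram_loewner_le_K1 {d n : ℕ} (X : Matrix (Fin d) (Fin n) ℝ)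
    (hX : ∀ i, (fun k => X k i) ≠ 0) :
    (K1mat X - (1 / 2 : ℝ) • (Xᵀ * X)).PosSemidef := by
  have hN : ∀ i, 0 < colNorm X i := by
    intro i
    refine Real.sqrt_pos.2 ?_
    obtain ⟨k, hk⟩ := Function.ne_iff.1 (hX i)
    refine Finset.sum_pos' (fun k _ => sq_nonneg _) ⟨k, Finset.mem_univ _, ?_⟩
    have : X k i ≠ 0 := hk
    positivity
  have hI : ∀ i j, colInner X i j = colInner X j i := fun i j =>
    Finset.sum_congr rfl fun k _ => mul_comm _ _
  set A : Matrix (Fin n) (Fin n) ℝ :=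
    Matrix.of fun i j => colInner X i j / (colNorm X i * colNorm X j) with hAdef
  have hA : A.PosSemidef := by
    have := Matrix.posSemidef_conjTranspose_mul_self
      (Matrix.of fun (k : Fin d) i => X k i / colNorm X i)
    convert this using 1
    ext i j
    simp only [hAdef, colInner, Matrix.mul_apply, Matrix.of_apply, Matrix.conjTranspose_apply,
      star_trivial, Finset.sum_div]
    exact Finset.sum_congr rfl fun k _ => by rw [div_mul_div_comm]
  have h1 : ∀ i j, |A i j| ≤ 1 := by
    intro i j
    have hp := mul_pos (hN i) (hN j)
    simp only [hAdef, Matrix.of_apply]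
    rw [abs_div, abs_of_pos hp, div_le_one hp]
    refine abs_le_of_sq_le_sq ?_ hp.le
    rw [mul_pow]
    unfold colNorm colInner
    rw [Real.sq_sqrt (Finset.sum_nonneg fun _ _ => sq_nonneg _),
      Real.sq_sqrt (Finset.sum_nonneg fun _ _ => sq_nonneg _)]
    exact Finset.sum_mul_sq_le_sq_mul_sq _ _ _
  have hs := ((psd_iff_aux A).1 hA).1
  have key : ∀ i j, (K1mat X - (1 / 2 : ℝ) • (Xᵀ * X)) i j = colNorm X i * colNorm X j *
      ((1 / Real.pi) * (√(1 - A i j ^ 2) + A i j * Real.arcsin (A i j))) := by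
    intro i j
    have e1 : (Xᵀ * X) i j = colNorm X i * colNorm X j * A i j := by
      have : (Xᵀ * X) i j = colInner X i j := by
        simp [Matrix.mul_apply, colInner]
      rw [this, hAdef, Matrix.of_apply, mul_div_cancel₀ _ (mul_pos (hN i) (hN j)).ne']
    have e2 : K1mat X i j = colNorm X i * colNorm X j * kappa1 (A i j) := rfl
    rw [Matrix.sub_apply, Matrix.smul_apply, e1, e2, kappa1, Real.arccos, smul_eq_mul]
    have := Real.pi_ne_zero
    field_simp
    ring
  rw [psd_iff_aux]
  refine ⟨fun i j => ?_, fun c => ?_⟩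
  · rw [key, key, hs i j]; ring
  · have := mul_nonneg (one_div_nonneg.2 Real.pi_pos.le)
      (quad_aux hA h1 fun i => c i * colNorm X i)
    refine this.trans_eq ?_
    simp only [key, Finset.mul_sum]
    refine Finset.sum_congr rfl fun i _ => Finset.sum_congr rfl fun j _ => by ring
end

section
/- For every n×n real positive semidefinite matrix M with tr(M) > 0 and every λ > 0, the statistical dimension satisfies tr(M·(M + λI)⁻¹) ≤ tr(M) / (tr(M)/n + λ). -/
open Matrix

theorem statDim_le_trace_ratio {n : ℕ} (M : Matrix (Fin n) (Fin n) ℝ)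
    (hM : M.PosSemidef) (htr : 0 < M.trace) (lam : ℝ) (hlam : 0 < lam) :
    (M * (M + lam • (1 : Matrix (Fin n) (Fin n) ℝ))⁻¹).trace ≤
      M.trace / (M.trace / (n : ℝ) + lam) := by
  have hn : (0 : ℝ) < n := by
    rcases Nat.eq_zero_or_pos n with h | h
    · subst h
      simp [Matrix.trace] at htr
    · exact_mod_cast h
  have hH := hM.isHermitian
  obtain ⟨d, hd⟩ : ∃ d, d = hH.eigenvalues := ⟨_, rfl⟩
  have hd0 : ∀ i, 0 ≤ d i := fun i => hd ▸ hM.eigenvalues_nonneg i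
  have ht : M.trace = ∑ i, d i := by
    rw [hH.trace_eq_sum_eigenvalues, hd]; simp
  obtain ⟨U, V, hUV, hVU, hMU⟩ : ∃ U V : Matrix (Fin n) (Fin n) ℝ,
      U * V = 1 ∧ V * U = 1 ∧ M = U * diagonal d * V := by
    refine ⟨hH.eigenvectorUnitary, star (hH.eigenvectorUnitary : Matrix (Fin n) (Fin n) ℝ),
      ?_, ?_, ?_⟩
    · simp
    · simp
    · have h := hH.spectral_theorem
      rw [Unitary.conjStarAlgAut_apply, ← hd] at h
      exact h
  have hinv : (M + lam • (1 : Matrix (Fin n) (Fin n) ℝ))⁻¹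
      = U * diagonal (fun i => (d i + lam)⁻¹) * V := by
    apply Matrix.inv_eq_right_inv
    have h1 : M + lam • (1 : Matrix (Fin n) (Fin n) ℝ)
        = U * diagonal (fun i => d i + lam) * V := by
      have : diagonal (fun i => d i + lam) = diagonal d + lam • (1 : Matrix (Fin n) (Fin n) ℝ) := by
        rw [smul_one_eq_diagonal, diagonal_add]
      rw [this, mul_add, add_mul, ← hMU]
      simp [hUV]
    rw [h1]
    calc _ = U * diagonal (fun i => d i + lam) * (V * U) *
          diagonal (fun i => (d i + lam)⁻¹) * V := by simp only [mul_assoc]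
      _ = 1 := by
        rw [hVU, mul_one, mul_assoc U, diagonal_mul_diagonal]
        have : (fun i => (d i + lam) * (d i + lam)⁻¹) = fun _ => 1 := by
          funext i
          exact mul_inv_cancel₀ (by linarith [hd0 i])
        rw [this, diagonal_one, mul_one, hUV]
  have hT : (M * (M + lam • (1 : Matrix (Fin n) (Fin n) ℝ))⁻¹).trace
      = ∑ i, d i * (d i + lam)⁻¹ := by
    rw [hinv]
    have : M * (U * diagonal (fun i => (d i + lam)⁻¹) * V)
        = U * diagonal (fun i => d i * (d i + lam)⁻¹) * V := by
      rw [← diagonal_mul_diagonal]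
      conv_lhs => rw [hMU]
      calc _ = U * diagonal d * (V * U) * diagonal (fun i => (d i + lam)⁻¹) * V := by
            simp only [mul_assoc]
        _ = _ := by rw [hVU, mul_one]; simp only [mul_assoc]
    rw [this, trace_mul_comm, ← mul_assoc, hVU, one_mul, trace_diagonal]
  rw [hT]
  obtain ⟨m, hm⟩ : ∃ m, m = M.trace / (n : ℝ) := ⟨_, rfl⟩
  have hm0 : 0 < m := hm ▸ div_pos htr hn
  have htm : M.trace = n * m := by rw [hm]; field_simp
  rw [← hm]
  have key : ∀ i, d i * (d i + lam)⁻¹ ≤ m / (m + lam) + lam / (m + lam) ^ 2 * (d i - m) := by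
    intro i
    have h1 : 0 < d i + lam := by linarith [hd0 i]
    have h2 : 0 < m + lam := by linarith
    have : m / (m + lam) + lam / (m + lam) ^ 2 * (d i - m) - d i * (d i + lam)⁻¹
        = lam * (d i - m) ^ 2 / ((m + lam) ^ 2 * (d i + lam)) := by
      field_simp
      ring
    have h3 : 0 ≤ lam * (d i - m) ^ 2 / ((m + lam) ^ 2 * (d i + lam)) := by positivity
    linarith
  refine (Finset.sum_le_sum fun i _ => key i).trans (le_of_eq ?_)
  rw [Finset.sum_add_distrib, ← Finset.mul_sum, Finset.sum_sub_distrib, ← ht, htm]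
  simp
  ring
end
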